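/- The category GW(𝕀_n, 𝒟_Ω) has only finitely many indecomposable modules up to isomorphism (is of finite representation type) if and only if Ω = ℤ^n and 𝒟_Ω = {1,…,n}; and in that case the simple 𝕀_n-module P_n = K[x_1,…,x_n] is the unique indecomposable module in GW(𝕀_n, 𝒟_Ω) up to isomorphism. -/

import Mathlib

set_option maxHeartbeats 1000000
set_option synthInstance.maxHeartbeats 400000
set_option linter.unusedSectionVars false

namespace IDO

open scoped TensorProduct

universe u

noncomputable section

variable (K : Type*) [Field K] [CharZero K] (n : ℕ)

/-- The polynomial algebra `P_n = K[x_1, …, x_n]`. -/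
abbrev P := MvPolynomial (Fin n) K

/-- The multiplication operator `x_i`. -/
def xOp (i : Fin n) : Module.End K (P K n) := LinearMap.mulLeft K (MvPolynomial.X i)

/-- The partial derivative `∂_i`. -/
def dOp (i : Fin n) : Module.End K (P K n) := (MvPolynomial.pderiv i).toLinearMap

/-- The integration operator `∫_i`, sending `x^α ↦ x^{α+e_i}/(α_i+1)`. -/
def intOp (i : Fin n) : Module.End K (P K n) :=
  ((MvPolynomial.basisMonomials (Fin n) K).constr K)
    (fun α => (((α i : ℕ) : K) + 1)⁻¹ •
      (MvPolynomial.monomial (α + Finsupp.single i 1) (1 : K)))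

/-- The algebra of polynomial integro-differential operators `𝕀_n`, as a subalgebra of
`End_K(P_n)` generated by the `x_i`, `∂_i` and `∫_i`. -/
def InSub : Subalgebra K (Module.End K (P K n)) :=
  Algebra.adjoin K (Set.range (xOp K n) ∪ Set.range (dOp K n) ∪ Set.range (intOp K n))

/-- The algebra `𝕀_n` (as a type, with its canonical ring structure). -/
def In : Type _ := InSub K n

instance : Ring (In K n) := inferInstanceAs (Ring (InSub K n))
instance : Algebra K (In K n) := inferInstanceAs (Algebra K (InSub K n))
instance : Module (In K n) (P K n) := inferInstanceAs (Module (InSub K n) (P K n))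
instance : IsScalarTower K (In K n) (P K n) :=
  inferInstanceAs (IsScalarTower K (InSub K n) (P K n))

/-- `x_i` as an element of `𝕀_n`. -/
def xEl (i : Fin n) : In K n :=
  show InSub K n from
    ⟨xOp K n i, Algebra.subset_adjoin (Set.mem_union_left _ (Set.mem_union_left _ ⟨i, rfl⟩))⟩

/-- `∂_i` as an element of `𝕀_n`. -/
def dEl (i : Fin n) : In K n :=
  show InSub K n from
    ⟨dOp K n i, Algebra.subset_adjoin (Set.mem_union_left _ (Set.mem_union_right _ ⟨i, rfl⟩))⟩

/-- `∫_i` as an element of `𝕀_n`. -/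
def intEl (i : Fin n) : In K n :=
  show InSub K n from
    ⟨intOp K n i, Algebra.subset_adjoin (Set.mem_union_right _ ⟨i, rfl⟩)⟩

/-- `H_i = ∂_i x_i` as an element of `𝕀_n`. -/
def HEl (i : Fin n) : In K n := dEl K n i * xEl K n i

section Modules

variable (M : Type*) [AddCommGroup M] [Module K M] [Module (In K n) M]
  [IsScalarTower K (In K n) M]

/-- The weight space `M_λ = {m | H_i m = λ_i m for all i}`. -/
def weightSpace (lam : Fin n → K) : Submodule K M where
  carrier := {m | ∀ i, HEl K n i • m = lam i • m}
  add_mem' := by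
    intro a b ha hb i
    rw [smul_add, ha i, hb i, smul_add]
  zero_mem' := by intro i; simp
  smul_mem' := by
    intro c m hm i
    rw [← smul_comm c (HEl K n i) m, hm i, smul_smul, mul_comm, ← smul_smul]

private lemma pow_smul_zero_mono {a : In K n} {m : M} {s s' : ℕ}
    (h : (a ^ s) • m = 0) (hle : s ≤ s') : (a ^ s') • m = 0 := by
  obtain ⟨k, rfl⟩ := Nat.exists_eq_add_of_le hle
  rw [add_comm s k, pow_add, mul_smul, h, smul_zero]

/-- The generalized weight space `M^λ = {m | (H_i − λ_i)^N m = 0 for some N and all i}`. -/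
def genWeightSpace (lam : Fin n → K) : Submodule K M where
  carrier := {m | ∃ N : ℕ, ∀ i,
    ((HEl K n i - algebraMap K (In K n) (lam i)) ^ N) • m = 0}
  add_mem' := by
    rintro a b ⟨Na, ha⟩ ⟨Nb, hb⟩
    refine ⟨Na ⊔ Nb, fun i => ?_⟩
    rw [smul_add, pow_smul_zero_mono K n M (ha i) le_sup_left,
      pow_smul_zero_mono K n M (hb i) le_sup_right, add_zero]
  zero_mem' := ⟨0, fun i => smul_zero _⟩
  smul_mem' := by
    rintro c m ⟨N, hN⟩
    exact ⟨N, fun i => by rw [← smul_comm c _ m, hN i, smul_zero]⟩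

/-- `M` is a weight module: `M = ⊕_λ M_λ`. -/
def IsWeightModule : Prop :=
  letI := Classical.decEq (Fin n → K)
  DirectSum.IsInternal (fun lam : Fin n → K => weightSpace K n M lam)

/-- `M` is a generalized weight module: `M = ⊕_λ M^λ`. -/
def IsGenWeightModule : Prop :=
  letI := Classical.decEq (Fin n → K)
  DirectSum.IsInternal (fun lam : Fin n → K => genWeightSpace K n M lam)

/-- The support `Supp(M) = {λ | M^λ ≠ 0}`. -/
def supp : Set (Fin n → K) := {lam | genWeightSpace K n M lam ≠ ⊥}

/-- `M` is an indecomposable `𝕀_n`-module. -/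
def IsIndecomposableMod : Prop :=
  Nontrivial M ∧ ∀ p q : Submodule (In K n) M, IsCompl p q → p = ⊥ ∨ q = ⊥

/-- The annihilator of an `𝕀_n`-module, as a set. -/
def annSet : Set (In K n) := {a | ∀ m : M, a • m = 0}

end Modules

/-- A prime (two-sided) ideal of the noncommutative ring `𝕀_n`, given as a set:
`S ≠ 𝕀_n` and `a 𝕀_n b ⊆ S → a ∈ S ∨ b ∈ S`. -/
def IsPrimeSet (S : Set (In K n)) : Prop :=
  S ≠ Set.univ ∧ ∀ a b : In K n, (∀ r : In K n, a * r * b ∈ S) → a ∈ S ∨ b ∈ S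

-- orbits
/-- The `ℤ^n`-orbit of `λ ∈ K^n`. -/
def orbitOf (lam : Fin n → K) : Set (Fin n → K) :=
  {mu | ∀ i, ∃ z : ℤ, mu i - lam i = (z : K)}

/-- The setoid on `K^n` whose classes are the `ℤ^n`-orbits. -/
def orbitSetoid : Setoid (Fin n → K) where
  r mu nu := ∀ i, ∃ z : ℤ, mu i - nu i = (z : K)
  iseqv := by
    constructor
    · intro x i; exact ⟨0, by simp⟩
    · intro x y h i
      obtain ⟨z, hz⟩ := h i
      exact ⟨-z, by push_cast; linear_combination -hz⟩
    · intro x y z hxy hyz i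
      obtain ⟨a, ha⟩ := hxy i
      obtain ⟨b, hb⟩ := hyz i
      exact ⟨a + b, by push_cast; linear_combination ha + hb⟩

/-- `𝔻_Ω = {i | Ω_i = ℤ}` for the orbit `Ω` of `λ`. -/
def DD (lam : Fin n → K) : Set (Fin n) := {i | ∃ z : ℤ, lam i = (z : K)}

/-- `λ` is the normalized representative of its orbit: integer coordinates are `0`. -/
def IsNormalized (lam : Fin n → K) : Prop := ∀ i, (∃ z : ℤ, lam i = (z : K)) → lam i = 0


-- I_1 specifics
/-- The matrix units `e_{st} = ∫^s ∂^t − ∫^{s+1} ∂^{t+1}` of `𝕀_1`. -/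
def eEl1 (s t : ℕ) : In K 1 :=
  intEl K 1 0 ^ s * dEl K 1 0 ^ t - intEl K 1 0 ^ (s + 1) * dEl K 1 0 ^ (t + 1)

/-- `F = ⊕ K e_{st}`, the unique proper two-sided ideal of `𝕀_1`, here as the left ideal
generated by the `e_{st}` (the two coincide). -/
def Fideal : Submodule (In K 1) (In K 1) :=
  Submodule.span (In K 1) {a | ∃ s t : ℕ, a = eEl1 K s t}

/-- The left ideal `F + 𝕀_1 (H − μ)^s`. -/
def MslIdeal (s : ℕ) (mu : K) : Submodule (In K 1) (In K 1) :=
  Fideal K ⊔ Submodule.span (In K 1) {(HEl K 1 0 - algebraMap K (In K 1) mu) ^ s}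

/-- The `𝕀_1`-module `M(s,μ) = 𝕀_1/(F + 𝕀_1 (H − μ)^s)`. -/
def Msl (s : ℕ) (mu : K) := (In K 1) ⧸ MslIdeal K s mu

instance (s : ℕ) (mu : K) : AddCommGroup (Msl K s mu) :=
  inferInstanceAs (AddCommGroup ((In K 1) ⧸ MslIdeal K s mu))
instance (s : ℕ) (mu : K) : Module (In K 1) (Msl K s mu) :=
  inferInstanceAs (Module (In K 1) ((In K 1) ⧸ MslIdeal K s mu))
instance (s : ℕ) (mu : K) : Module K (Msl K s mu) :=
  inferInstanceAs (Module K ((In K 1) ⧸ MslIdeal K s mu))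
instance (s : ℕ) (mu : K) : IsScalarTower K (In K 1) (Msl K s mu) :=
  inferInstanceAs (IsScalarTower K (In K 1) ((In K 1) ⧸ MslIdeal K s mu))

-- two-sided ideals of I_n
/-- The element `e_{st}(i) ∈ 𝕀_n` built from the `i`-th tensor factor. -/
def eElN (i : Fin n) (s t : ℕ) : In K n :=
  intEl K n i ^ s * dEl K n i ^ t - intEl K n i ^ (s + 1) * dEl K n i ^ (t + 1)

/-- The height one prime `𝔭_i`, the two-sided ideal of `𝕀_n` generated by `F(i)`. -/
def pIdeal (i : Fin n) : TwoSidedIdeal (In K n) :=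
  TwoSidedIdeal.span {a | ∃ s t : ℕ, a = eElN K n i s t}

/-- `𝔞_n(I) = Σ_{i ∈ I} 𝔭_i`. -/
def aIdeal (I : Set (Fin n)) : TwoSidedIdeal (In K n) := ⨆ i ∈ I, pIdeal K n i


-- bundled modules
/-- A bundled `𝕀_n`-module (with compatible `K`-structure). -/
structure ModN (K : Type u) [Field K] [CharZero K] (n : ℕ) : Type (u + 1) where
  carrier : Type u
  [instAdd : AddCommGroup carrier]
  [instK : Module K carrier]
  [instIn : Module (In K n) carrier]
  [instTower : IsScalarTower K (In K n) carrier]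

attribute [instance] ModN.instAdd ModN.instK ModN.instIn ModN.instTower

/-- The endomorphism of `M_1 ⊗ ⋯ ⊗ M_n` acting by `a ∈ 𝕀_1` on the `i`-th factor. -/
def tprodMap (Mi : Fin n → ModN K 1) (i : Fin n) (a : In K 1) :
    (⨂[K] j, (Mi j).carrier) →ₗ[K] ⨂[K] j, (Mi j).carrier :=
  PiTensorProduct.map (Function.update
    (fun j => (LinearMap.id : (Mi j).carrier →ₗ[K] (Mi j).carrier)) i
    (DistribMulAction.toLinearMap K ((Mi i).carrier) a))

/-- The `𝕀_n`-module `M` "is" the tensor product `M_1 ⊗ ⋯ ⊗ M_n` of the `𝕀_1`-modules `M_i`: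
there is a `K`-linear isomorphism under which the generators `x_i, ∂_i, ∫_i` of `𝕀_n` act on
the `i`-th tensor factor via the corresponding generators of `𝕀_1`. -/
def RealizesTensor (Mi : Fin n → ModN K 1) (M : Type*) [AddCommGroup M] [Module K M]
    [Module (In K n) M] [IsScalarTower K (In K n) M] : Prop :=
  ∃ φ : M ≃ₗ[K] ⨂[K] j, (Mi j).carrier,
    ∀ (i : Fin n) (m : M),
      φ (xEl K n i • m) = tprodMap K n Mi i (xEl K 1 0) (φ m) ∧
      φ (dEl K n i • m) = tprodMap K n Mi i (dEl K 1 0) (φ m) ∧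
      φ (intEl K n i • m) = tprodMap K n Mi i (intEl K 1 0) (φ m)

/-- `M` is (isomorphic to) the simple weight module `M(𝒟_Ω)` attached to the orbit of `λ`
and the subset `𝒟 ⊆ 𝔻_Ω`: the tensor product of copies of `K[x]` (for `i ∈ 𝒟`) and of
`M(1, λ_i)` (for `i ∉ 𝒟`). -/
def RealizesMD (lam : Fin n → K) (D : Set (Fin n)) (M : Type*) [AddCommGroup M] [Module K M]
    [Module (In K n) M] [IsScalarTower K (In K n) M] : Prop :=
  ∃ Mi : Fin n → ModN K 1,
    (∀ i, i ∈ D → Nonempty ((Mi i).carrier ≃ₗ[In K 1] P K 1)) ∧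
    (∀ i, i ∉ D → Nonempty ((Mi i).carrier ≃ₗ[In K 1] Msl K 1 (lam i))) ∧
    RealizesTensor K n Mi M

/-- `M` is (isomorphic to) the module `P_{n-1} ⊗ M(s, λ)` (with the copy of `M(s,λ)` placed
in position `j`). -/
def RealizesPMs (lam : Fin n → K) (j : Fin n) (s : ℕ) (M : Type*) [AddCommGroup M] [Module K M]
    [Module (In K n) M] [IsScalarTower K (In K n) M] : Prop :=
  ∃ Mi : Fin n → ModN K 1,
    (∀ i, i ≠ j → Nonempty ((Mi i).carrier ≃ₗ[In K 1] P K 1)) ∧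
    Nonempty ((Mi j).carrier ≃ₗ[In K 1] Msl K s (lam j)) ∧
    RealizesTensor K n Mi M

/-- Membership in the category `GW(𝕀_n, 𝒟_Ω)`: generalized weight modules with support in the
orbit of `λ` all of whose simple subquotients are isomorphic to `M(𝒟_Ω)`. -/
def InGWD (lam : Fin n → K) (D : Set (Fin n)) (M : Type*) [AddCommGroup M] [Module K M]
    [Module (In K n) M] [IsScalarTower K (In K n) M] : Prop :=
  IsGenWeightModule K n M ∧ supp K n M ⊆ orbitOf K n lam ∧
  ∀ (p q : Submodule (In K n) M), p ≤ q →
    IsSimpleModule (In K n) (q ⧸ Submodule.comap q.subtype p) →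
    RealizesMD K n lam D (q ⧸ Submodule.comap q.subtype p)

/-- The support `S(𝒟_Ω) = ℕ_+^{𝒟_Ω} × ∏_{i ∉ 𝒟_Ω} (λ_i + ℤ)` of the module `M(𝒟_Ω)`. -/
def SuppMD (lam : Fin n → K) (D : Set (Fin n)) : Set (Fin n → K) :=
  {mu | (∀ i ∈ D, ∃ m : ℕ, 0 < m ∧ mu i = (m : K)) ∧
        (∀ i ∉ D, ∃ z : ℤ, mu i = lam i + (z : K))}

/-- `M` is an absolutely prime `𝕀_n`-module: its annihilator is a prime ideal and every
nonzero subfactor of `M` has the same annihilator. -/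
def IsAbsolutelyPrime (M : Type*) [AddCommGroup M] [Module K M]
    [Module (In K n) M] [IsScalarTower K (In K n) M] : Prop :=
  IsPrimeSet K n (annSet K n M) ∧
  ∀ (p q : Submodule (In K n) M), p ≤ q →
    Nontrivial (q ⧸ Submodule.comap q.subtype p) →
    annSet K n (q ⧸ Submodule.comap q.subtype p) = annSet K n M


-- the commutative subalgebra D_n = K[H_1, …, H_n]
lemma xEl_smul (i : Fin n) (p : P K n) : xEl K n i • p = MvPolynomial.X i * p := rfl

lemma dEl_smul (i : Fin n) (p : P K n) : dEl K n i • p = MvPolynomial.pderiv i p := rfl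

lemma hEl_monomial (i : Fin n) (α : Fin n →₀ ℕ) (c : K) :
    HEl K n i • (MvPolynomial.monomial α c : P K n)
      = (((α i : ℕ) : K) + 1) • MvPolynomial.monomial α c := by
  have hx : xEl K n i • (MvPolynomial.monomial α c : P K n)
      = MvPolynomial.monomial (α + Finsupp.single i 1) c := by
    rw [xEl_smul, MvPolynomial.X, MvPolynomial.monomial_mul, one_mul, add_comm]
  rw [HEl, mul_smul, hx, dEl_smul, MvPolynomial.pderiv_monomial,
    add_tsub_cancel_right, MvPolynomial.smul_monomial, Finsupp.add_apply,
    Finsupp.single_eq_same, smul_eq_mul]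
  congr 1
  push_cast
  ring

private lemma In_ext {a b : In K n} (h : ∀ p : P K n, a • p = b • p) : a = b := by
  have : (show InSub K n from a) = (show InSub K n from b) :=
    Subtype.ext (LinearMap.ext fun p => h p)
  exact this

lemma hEl_comm (i j : Fin n) : HEl K n i * HEl K n j = HEl K n j * HEl K n i := by
  apply In_ext
  intro p
  induction p using MvPolynomial.induction_on' with
  | monomial α c =>
      have key : ∀ a b : Fin n, (HEl K n a * HEl K n b) • (MvPolynomial.monomial α c : P K n)
          = ((((α b : ℕ) : K) + 1) * (((α a : ℕ) : K) + 1)) • MvPolynomial.monomial α c := by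
        intro a b
        rw [mul_smul, hEl_monomial, ← smul_comm, hEl_monomial, smul_smul]
      rw [key, key, mul_comm]
  | add p q hp hq =>
      rw [smul_add, smul_add, hp, hq]

/-- `D_n = K[H_1, …, H_n]` as a subalgebra of `𝕀_n`. -/
def DnSub : Subalgebra K (In K n) := Algebra.adjoin K (Set.range (HEl K n))

/-- The commutative algebra `D_n` (as a type). -/
def Dn : Type _ := DnSub K n

instance : CommRing (Dn K n) :=
  Algebra.adjoinCommRingOfComm K (by rintro a ⟨i, rfl⟩ b ⟨j, rfl⟩; exact hEl_comm K n i j)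

instance : Algebra K (Dn K n) := inferInstanceAs (Algebra K (DnSub K n))

/-- The inclusion `D_n → 𝕀_n`. -/
def dnVal : Dn K n →+* In K n := ((DnSub K n).val : DnSub K n →ₐ[K] In K n).toRingHom

/-- `H_i` as an element of `D_n`. -/
def HElD (i : Fin n) : Dn K n :=
  show DnSub K n from ⟨HEl K n i, Algebra.subset_adjoin ⟨i, rfl⟩⟩

lemma dn_comm (d : Dn K n) (i : Fin n) :
    dnVal K n d * HEl K n i = HEl K n i * dnVal K n d := by
  have h1 : DnSub K n ≤ Subalgebra.centralizer K (Set.range (HEl K n)) := by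
    apply Algebra.adjoin_le
    rintro x ⟨j, rfl⟩
    rw [SetLike.mem_coe, Subalgebra.mem_centralizer_iff]
    rintro g ⟨i', rfl⟩
    exact hEl_comm K n i' j
  have h2 := (Subalgebra.mem_centralizer_iff K).mp
    (h1 (show DnSub K n from d).2) (HEl K n i) ⟨i, rfl⟩
  exact h2.symm


section DnModules

variable (M : Type*) [AddCommGroup M] [Module K M] [Module (In K n) M]
  [IsScalarTower K (In K n) M]

lemma genWS_stable (lam : Fin n → K) {m : M} (hm : m ∈ genWeightSpace K n M lam)
    (d : Dn K n) : dnVal K n d • m ∈ genWeightSpace K n M lam := by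
  obtain ⟨N, hN⟩ := hm
  refine ⟨N, fun i => ?_⟩
  have hc : Commute (dnVal K n d) ((HEl K n i - algebraMap K (In K n) (lam i)) ^ N) := by
    apply Commute.pow_right
    exact Commute.sub_right (dn_comm K n d i) ((Algebra.commutes (lam i) (dnVal K n d)).symm)
  rw [← mul_smul, ← hc.eq, mul_smul, hN i, smul_zero]

instance genWS_smul (lam : Fin n → K) : SMul (Dn K n) (genWeightSpace K n M lam) :=
  ⟨fun d w => ⟨dnVal K n d • (w : M), genWS_stable K n M lam w.2 d⟩⟩

instance genWS_module (lam : Fin n → K) : Module (Dn K n) (genWeightSpace K n M lam) :=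
  Module.ofMinimalAxioms
    (fun d x y => Subtype.ext (smul_add (dnVal K n d) (x : M) (y : M)))
    (fun d d' x => Subtype.ext (show dnVal K n (d + d') • (x : M)
      = dnVal K n d • (x : M) + dnVal K n d' • (x : M) by rw [map_add, add_smul]))
    (fun d d' x => Subtype.ext (show dnVal K n (d * d') • (x : M)
      = dnVal K n d • (dnVal K n d' • (x : M)) by rw [map_mul, mul_smul]))
    (fun x => Subtype.ext (show dnVal K n 1 • (x : M) = (x : M) by rw [map_one, one_smul]))

instance genWS_tower (lam : Fin n → K) :
    IsScalarTower K (Dn K n) (genWeightSpace K n M lam) :=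
  ⟨fun c d w => Subtype.ext (show dnVal K n (c • d) • (w : M) = c • (dnVal K n d • (w : M)) by
    rw [show dnVal K n (c • d) = c • dnVal K n d from map_smul (DnSub K n).val c d, smul_assoc])⟩

end DnModules

/-- The maximal ideal `𝔪_λ = (H_1 − λ_1, …, H_n − λ_n)` of `D_n`. -/
def mIdeal (lam : Fin n → K) : Ideal (Dn K n) :=
  Ideal.span {d | ∃ i, d = HElD K n i - algebraMap K (Dn K n) (lam i)}

/-- The category `LF_𝔪(D_n)` of `𝔪_λ`-locally finite `D_n`-modules: every cyclic submodule is
finite dimensional over `K` and annihilated by a power of `𝔪_λ`. -/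
def IsLF (lam : Fin n → K) (N : Type*) [AddCommGroup N] [Module K N] [Module (Dn K n) N]
    [IsScalarTower K (Dn K n) N] : Prop :=
  ∀ x : N, FiniteDimensional K ((Submodule.span (Dn K n) {x}).restrictScalars K) ∧
    ∃ s : ℕ, ∀ i, ((HElD K n i - algebraMap K (Dn K n) (lam i)) ^ s) • x = 0

-- the algebra B_n = 𝕀_n/𝔞_n
/-- The maximal ideal `𝔞_n = 𝔭_1 + ⋯ + 𝔭_n` of `𝕀_n`. -/
def aFull : TwoSidedIdeal (In K n) := aIdeal K n Set.univ

/-- The skew Laurent polynomial algebra `B_n = 𝕀_n/𝔞_n`. -/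
def Bn : Type _ := (aFull K n).ringCon.Quotient

instance : Ring (Bn K n) := inferInstanceAs (Ring (aFull K n).ringCon.Quotient)

/-- The quotient map `𝕀_n → B_n`. -/
def toBn : In K n →+* Bn K n := RingCon.mk' _

lemma toBn_surjective : Function.Surjective (toBn K n) :=
  Quotient.mk''_surjective

/-- The composite `D_n → 𝕀_n → B_n`. -/
def bnD : Dn K n →+* Bn K n := (toBn K n).comp (dnVal K n)

/-- `B_n` as a right `D_n`-module (written as a left module structure, `d • b = b ⬝ d`). -/
instance : SMul (Dn K n) (Bn K n) := ⟨fun d b => b * bnD K n d⟩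

instance : Module (Dn K n) (Bn K n) :=
  Module.ofMinimalAxioms
    (fun d x y => show (x + y) * bnD K n d = x * bnD K n d + y * bnD K n d from add_mul _ _ _)
    (fun d d' x => show x * bnD K n (d + d') = x * bnD K n d + x * bnD K n d' by
      rw [map_add, mul_add])
    (fun d d' x => show x * bnD K n (d * d') = (x * bnD K n d') * bnD K n d by
      rw [mul_comm d d', map_mul, ← mul_assoc])
    (fun x => show x * bnD K n 1 = x by rw [map_one, mul_one])

instance : SMulCommClass (Dn K n) (Bn K n) (Bn K n) :=
  ⟨fun d b m => show (b * m) * bnD K n d = b * (m * bnD K n d) from mul_assoc b m (bnD K n d)⟩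

/-- The induced module `B_n ⊗_{D_n} N` of a `D_n`-module `N`. -/
def Ind (N : Type*) [AddCommGroup N] [Module (Dn K n) N] : Type _ :=
  (Bn K n) ⊗[Dn K n] N

section Ind

variable (N : Type*) [AddCommGroup N] [Module (Dn K n) N]

instance : AddCommGroup (Ind K n N) :=
  inferInstanceAs (AddCommGroup ((Bn K n) ⊗[Dn K n] N))

instance indModuleBn : Module (Bn K n) (Ind K n N) :=
  inferInstanceAs (Module (Bn K n) ((Bn K n) ⊗[Dn K n] N))

instance indModuleDn : Module (Dn K n) (Ind K n N) :=
  inferInstanceAs (Module (Dn K n) ((Bn K n) ⊗[Dn K n] N))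

instance indModuleIn : Module (In K n) (Ind K n N) := Module.compHom _ (toBn K n)

instance indModuleK : Module K (Ind K n N) := Module.compHom _ (algebraMap K (Dn K n))

lemma bn_algebraMap_comm (c : K) (u : Bn K n) :
    toBn K n (algebraMap K (In K n) c) * u = u * toBn K n (algebraMap K (In K n) c) := by
  obtain ⟨r, rfl⟩ := toBn_surjective K n u
  rw [← map_mul, ← map_mul, Algebra.commutes]

lemma dnVal_algebraMap (c : K) :
    dnVal K n (algebraMap K (Dn K n) c) = algebraMap K (In K n) c :=
  AlgHom.commutes (DnSub K n).val c

lemma ind_key (c : K) (w : (Bn K n) ⊗[Dn K n] N) :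
    (toBn K n (algebraMap K (In K n) c)) • w = (algebraMap K (Dn K n) c) • w := by
  induction w using TensorProduct.induction_on with
  | zero => rw [smul_zero, smul_zero]
  | tmul b x =>
      rw [TensorProduct.smul_tmul', TensorProduct.smul_tmul']
      congr 1
      show toBn K n (algebraMap K (In K n) c) * b = b * bnD K n (algebraMap K (Dn K n) c)
      have h1 : bnD K n (algebraMap K (Dn K n) c) = toBn K n (algebraMap K (In K n) c) := by
        show toBn K n (dnVal K n (algebraMap K (Dn K n) c)) = _
        rw [dnVal_algebraMap]
      rw [h1, bn_algebraMap_comm]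
  | add x y hx hy => rw [smul_add, smul_add, hx, hy]

instance indTower : IsScalarTower K (In K n) (Ind K n N) := by
  constructor
  intro c a v
  show toBn K n (c • a) • v = algebraMap K (Dn K n) c • ((toBn K n a : Bn K n) • v)
  rw [Algebra.smul_def, map_mul, mul_smul]
  exact ind_key K n N c _

end Ind


section BnQuot

variable (J : Submodule (Bn K n) (Bn K n))

instance : Module (In K n) (Bn K n ⧸ J) := Module.compHom _ (toBn K n)

instance : Module K (Bn K n ⧸ J) :=
  Module.compHom _ ((toBn K n).comp (algebraMap K (In K n)))

instance : IsScalarTower K (In K n) (Bn K n ⧸ J) := by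
  constructor
  intro c a v
  show toBn K n (c • a) • v = (toBn K n (algebraMap K (In K n) c)) • (toBn K n a • v)
  rw [Algebra.smul_def, map_mul, mul_smul]

end BnQuot

/-- The `𝕀_n`-module `M` "is" the tensor product `A ⊗ B` of an `𝕀_m`-module `A` and an
`𝕀_{n-m}`-module `B`: there is a `K`-linear isomorphism under which the generators of `𝕀_n`
with index `< m` act on the first factor (via the corresponding generators of `𝕀_m`) and the
remaining generators act on the second factor (via the generators of `𝕀_{n-m}`). -/
def RealizesSplit (m : ℕ) (A : Type*) [AddCommGroup A] [Module K A] [Module (In K m) A]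
    [IsScalarTower K (In K m) A]
    (B : Type*) [AddCommGroup B] [Module K B] [Module (In K (n - m)) B]
    [IsScalarTower K (In K (n - m)) B]
    (M : Type*) [AddCommGroup M] [Module K M] [Module (In K n) M]
    [IsScalarTower K (In K n) M] : Prop :=
  ∃ φ : M ≃ₗ[K] A ⊗[K] B,
    (∀ (i : Fin n) (hi : (i : ℕ) < m) (v : M),
      φ (xEl K n i • v) = LinearMap.rTensor B
        (DistribMulAction.toLinearMap K A (xEl K m ⟨i, hi⟩)) (φ v) ∧
      φ (dEl K n i • v) = LinearMap.rTensor B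
        (DistribMulAction.toLinearMap K A (dEl K m ⟨i, hi⟩)) (φ v) ∧
      φ (intEl K n i • v) = LinearMap.rTensor B
        (DistribMulAction.toLinearMap K A (intEl K m ⟨i, hi⟩)) (φ v)) ∧
    (∀ (i : Fin n) (hi : m ≤ (i : ℕ)) (v : M),
      φ (xEl K n i • v) = LinearMap.lTensor A
        (DistribMulAction.toLinearMap K B (xEl K (n - m) ⟨(i : ℕ) - m, by omega⟩)) (φ v) ∧
      φ (dEl K n i • v) = LinearMap.lTensor A
        (DistribMulAction.toLinearMap K B (dEl K (n - m) ⟨(i : ℕ) - m, by omega⟩)) (φ v) ∧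
      φ (intEl K n i • v) = LinearMap.lTensor A
        (DistribMulAction.toLinearMap K B (intEl K (n - m) ⟨(i : ℕ) - m, by omega⟩)) (φ v))

end



set_option maxHeartbeats 1000000
set_option synthInstance.maxHeartbeats 400000
set_option linter.unusedSectionVars false
set_option linter.style.haveILetI false

noncomputable section PartA

section

variable {K : Type*} [Field K] [CharZero K] {n : ℕ}

lemma in_ext' {a b : In K n} (h : ∀ p : P K n, a • p = b • p) : a = b := by
  have : (show InSub K n from a) = (show InSub K n from b) :=
    Subtype.ext (LinearMap.ext fun p => h p)
  exact this

lemma in_induct {C : In K n → Prop} (hx : ∀ i, C (xEl K n i)) (hd : ∀ i, C (dEl K n i))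
    (hi : ∀ i, C (intEl K n i)) (ha : ∀ c, C (algebraMap K (In K n) c))
    (hadd : ∀ a b, C a → C b → C (a + b)) (hmul : ∀ a b, C a → C b → C (a * b))
    (a : In K n) : C a := by
  obtain ⟨a, h⟩ := a
  refine Algebra.adjoin_induction (p := fun a h => C ⟨a, h⟩) ?_ ?_ ?_ ?_ h
  · rintro x ((⟨i, rfl⟩ | ⟨i, rfl⟩) | ⟨i, rfl⟩)
    · exact hx i
    · exact hd i
    · exact hi i
  · intro r; exact ha r
  · intro x y _ _ h1 h2; exact hadd _ _ h1 h2
  · intro x y _ _ h1 h2; exact hmul _ _ h1 h2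

lemma linear_of_gens {M N : Type*} [AddCommGroup M] [Module K M] [Module (In K n) M]
    [IsScalarTower K (In K n) M] [AddCommGroup N] [Module K N] [Module (In K n) N]
    [IsScalarTower K (In K n) N] (f : M →ₗ[K] N)
    (hx : ∀ i m, f (xEl K n i • m) = xEl K n i • f m)
    (hd : ∀ i m, f (dEl K n i • m) = dEl K n i • f m)
    (hi : ∀ i m, f (intEl K n i • m) = intEl K n i • f m) (a : In K n) :
    ∀ m, f (a • m) = a • f m := by
  induction a using in_induct with
  | hx i => exact hx i
  | hd i => exact hd i
  | hi i => exact hi i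
  | ha c => intro m; rw [algebraMap_smul, algebraMap_smul, map_smul]
  | hadd a b h1 h2 => intro m; rw [add_smul, add_smul, map_add, h1, h2]
  | hmul a b h1 h2 => intro m; rw [mul_smul, mul_smul, h1, h2]

/-- In-linear map from generators. -/
def mkIn {M N : Type*} [AddCommGroup M] [Module K M] [Module (In K n) M]
    [IsScalarTower K (In K n) M] [AddCommGroup N] [Module K N] [Module (In K n) N]
    [IsScalarTower K (In K n) N] (f : M →ₗ[K] N)
    (hx : ∀ i m, f (xEl K n i • m) = xEl K n i • f m)
    (hd : ∀ i m, f (dEl K n i • m) = dEl K n i • f m)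
    (hi : ∀ i m, f (intEl K n i • m) = intEl K n i • f m) : M →ₗ[In K n] N :=
  { toFun := f, map_add' := map_add f, map_smul' := fun a m => linear_of_gens f hx hd hi a m }

/-- abstract construction of a representation -/
lemma exists_rep {V : Type*} [AddCommGroup V] [Module K V] (X Dd I : Fin n → Module.End K V)
    (B : Subalgebra K (Module.End K (P K n) × Module.End K V))
    (hX : ∀ i, (xOp K n i, X i) ∈ B) (hDd : ∀ i, (dOp K n i, Dd i) ∈ B)
    (hI : ∀ i, (intOp K n i, I i) ∈ B) (h0 : ∀ T, ((0 : Module.End K (P K n)), T) ∈ B → T = 0) :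
    ∃ ρ : In K n →ₐ[K] Module.End K V, (∀ i, ρ (xEl K n i) = X i) ∧ (∀ i, ρ (dEl K n i) = Dd i) ∧
      (∀ i, ρ (intEl K n i) = I i) := by
  have huniq : ∀ T T1 T2, (T, T1) ∈ B → (T, T2) ∈ B → T1 = T2 := by
    intro T T1 T2 h1 h2
    have := B.sub_mem h1 h2
    rw [Prod.mk_sub_mk, sub_self] at this
    exact sub_eq_zero.mp (h0 _ this)
  have hex : ∀ a : In K n, ∃ T, ((InSub K n).val a, T) ∈ B := by
    intro a
    induction a using in_induct with
    | hx i => exact ⟨_, hX i⟩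
    | hd i => exact ⟨_, hDd i⟩
    | hi i => exact ⟨_, hI i⟩
    | ha c => exact ⟨algebraMap K _ c, B.algebraMap_mem c⟩
    | hadd a b h1 h2 =>
      obtain ⟨T1, h1⟩ := h1; obtain ⟨T2, h2⟩ := h2
      exact ⟨T1 + T2, B.add_mem h1 h2⟩
    | hmul a b h1 h2 =>
      obtain ⟨T1, h1⟩ := h1; obtain ⟨T2, h2⟩ := h2
      exact ⟨T1 * T2, B.mul_mem h1 h2⟩
  choose ρ hρ using hex
  refine ⟨{ toFun := ρ
            map_one' := ?_
            map_mul' := ?_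
            map_zero' := ?_
            map_add' := ?_
            commutes' := ?_ }, ?_, ?_, ?_⟩
  · exact huniq _ _ _ (hρ 1) B.one_mem
  · intro a b; exact huniq _ _ _ (hρ (a * b)) (B.mul_mem (hρ a) (hρ b))
  · exact huniq _ _ _ (hρ 0) B.zero_mem
  · intro a b; exact huniq _ _ _ (hρ (a + b)) (B.add_mem (hρ a) (hρ b))
  · intro c; exact huniq _ _ _ (hρ _) (B.algebraMap_mem c)
  · intro i; exact huniq _ _ _ (hρ _) (hX i)
  · intro i; exact huniq _ _ _ (hρ _) (hDd i)
  · intro i; exact huniq _ _ _ (hρ _) (hI i)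

/-- index set -/
abbrev Sx (D : Set (Fin n)) : Type := {α : Fin n → ℤ // ∀ i ∈ D, 0 ≤ α i}

/-- raise index -/
def Sx.up {D : Set (Fin n)} (α : Sx D) (i : Fin n) : Sx D :=
  ⟨α.1 + Pi.single i 1, fun j hj => by
    have := α.2 j hj
    by_cases h : j = i
    · subst h; simp; omega
    · simp [h, this]⟩

/-- can lower -/
def Sx.can {D : Set (Fin n)} (α : Sx D) (i : Fin n) : Prop := i ∈ D → 0 < α.1 i

/-- lower index -/
def Sx.down {D : Set (Fin n)} (α : Sx D) (i : Fin n) (h : α.can i) : Sx D :=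
  ⟨α.1 - Pi.single i 1, fun j hj => by
    have := α.2 j hj
    by_cases hh : j = i
    · subst hh; have := h hj; simp; omega
    · simp [hh, this]⟩

lemma Sx.up_can {D : Set (Fin n)} (α : Sx D) (i : Fin n) : (α.up i).can i := by
  intro h
  have := α.2 i h
  simp [Sx.up]; omega

lemma Sx.down_up {D : Set (Fin n)} (α : Sx D) (i : Fin n) : (α.up i).down i (α.up_can i) = α := by
  apply Subtype.ext; simp [Sx.up, Sx.down]

lemma Sx.up_down {D : Set (Fin n)} (α : Sx D) (i : Fin n) (h) : (α.down i h).up i = α := by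
  apply Subtype.ext; simp [Sx.up, Sx.down]

variable (D : Set (Fin n)) {R : Type*} [CommRing R] [Algebra K R] (τ : Fin n → R)

open scoped Classical in
/-- derivative -/
def vd (i : Fin n) : Module.End K (Sx D →₀ R) :=
  Finsupp.lsum K fun α => if h : α.can i then Finsupp.lsingle (α.down i h) else 0

/-- integral -/
def vi (i : Fin n) : Module.End K (Sx D →₀ R) :=
  Finsupp.lsum K fun α => Finsupp.lsingle (α.up i)

/-- multiplication -/
def vx (i : Fin n) : Module.End K (Sx D →₀ R) :=
  Finsupp.lsum K fun α => (Finsupp.lsingle (α.up i)).comp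
    (LinearMap.mulLeft K (τ i + ((α.1 i : ℤ) : R)))

open scoped Classical in
lemma vd_single (i : Fin n) (α : Sx D) (r : R) : vd (K := K) D i (Finsupp.single α r) =
    if h : α.can i then Finsupp.single (α.down i h) r else 0 := by
  rw [vd, Finsupp.lsum_single]
  split_ifs <;> rfl

lemma vi_single (i : Fin n) (α : Sx D) (r : R) : vi (K := K) D i (Finsupp.single α r) =
    Finsupp.single (α.up i) r := by
  rw [vi, Finsupp.lsum_single]; rfl

lemma vx_single (i : Fin n) (α : Sx D) (r : R) : vx (K := K) D τ i (Finsupp.single α r) =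
    Finsupp.single (α.up i) ((τ i + ((α.1 i : ℤ) : R)) * r) := by
  rw [vx, Finsupp.lsum_single]; rfl

variable (K) in
/-- exponent -/
def toExp (β : Fin n → ℤ) : Fin n →₀ ℕ := Finsupp.equivFunOnFinite.symm fun i => (β i).toNat

variable (K) in
open scoped Classical in
/-- normalized monomial -/
def qm (β : Fin n → ℤ) : P K n :=
  if ∀ i, 0 ≤ β i then MvPolynomial.monomial (toExp β) (∏ i, (((β i).toNat.factorial : K))⁻¹) else 0

lemma fact_prod (β : Fin n → ℤ) (h : ∀ i, 0 ≤ β i) (i : Fin n) :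
    (∏ j, (((β j).toNat.factorial : K))⁻¹) = ((β i : K) + 1) *
      ∏ j, ((((β + Pi.single i 1 : Fin n → ℤ) j).toNat.factorial : K))⁻¹ := by
  have h1 : (β + Pi.single i 1 : Fin n → ℤ) i = β i + 1 := by simp
  have h2 : ∀ j, j ≠ i → (β + Pi.single i 1 : Fin n → ℤ) j = β j := by intro j hj; simp [hj]
  generalize (β + Pi.single i 1 : Fin n → ℤ) = γ at h1 h2 ⊢
  rw [← Finset.mul_prod_erase Finset.univ (fun j => (((β j).toNat.factorial : K))⁻¹)
      (Finset.mem_univ i),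
    ← Finset.mul_prod_erase Finset.univ (fun j => (((γ j).toNat.factorial : K))⁻¹)
      (Finset.mem_univ i), ← mul_assoc]
  congr 1
  · obtain ⟨b, hb⟩ := Int.eq_ofNat_of_zero_le (h i)
    have : (((b:ℤ) + 1)).toNat = b + 1 := by omega
    simp only [h1, hb, this, Int.toNat_natCast, Nat.factorial_succ]
    have h1 : (b.factorial : K) ≠ 0 := by exact_mod_cast b.factorial_ne_zero
    have h2 : (b : K) + 1 ≠ 0 := by exact_mod_cast b.succ_ne_zero
    push_cast
    field_simp
  · refine Finset.prod_congr rfl fun j hj => ?_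
    rw [h2 j (Finset.ne_of_mem_erase hj)]

lemma toExp_up (β : Fin n → ℤ) (i : Fin n) (h : 0 ≤ β i) :
    toExp (β + Pi.single i 1) = toExp β + Finsupp.single i 1 := by
  ext j
  by_cases hj : j = i
  · subst hj; simp [toExp]; omega
  · simp [toExp, hj]

lemma nonneg_up (β : Fin n → ℤ) (i : Fin n) (h : 0 ≤ β i) :
    (∀ j, 0 ≤ (β + Pi.single i 1 : Fin n → ℤ) j) ↔ ∀ j, 0 ≤ β j := by
  refine forall_congr' fun j => ?_
  by_cases hj : j = i
  · subst hj; simp; omega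
  · simp [hj]

lemma xOp_qm (β : Fin n → ℤ) (i : Fin n) :
    xOp K n i (qm K β) = ((β i : K) + 1) • qm K (β + Pi.single i 1) := by
  by_cases hi : 0 ≤ β i
  · unfold qm
    rw [if_congr (nonneg_up β i hi) rfl rfl]
    split_ifs with h
    · rw [toExp_up β i hi, MvPolynomial.smul_monomial, smul_eq_mul, ← fact_prod β h i]
      simp [xOp, MvPolynomial.X, MvPolynomial.monomial_mul, add_comm]
    · simp
  · rw [qm, if_neg (fun h => hi (h i)), map_zero]
    by_cases h1 : β i = -1
    · simp [h1]
    · rw [qm, if_neg, smul_zero]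
      intro h
      have := h i
      simp at this; omega

lemma intOp_qm (β : Fin n → ℤ) (i : Fin n) (hi : 0 ≤ β i) :
    intOp K n i (qm K β) = qm K (β + Pi.single i 1) := by
  unfold qm
  rw [if_congr (nonneg_up β i hi) rfl rfl]
  split_ifs with h
  · have : ∀ (a : Fin n →₀ ℕ) (c : K), intOp K n i (MvPolynomial.monomial a c) =
        MvPolynomial.monomial (a + Finsupp.single i 1) ((((a i : ℕ) : K) + 1)⁻¹ * c) := by
      intro a c
      have e : (MvPolynomial.monomial a c : P K n) = c • MvPolynomial.basisMonomials (Fin n) K a := by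
        simp [MvPolynomial.smul_monomial]
      rw [e, map_smul, intOp, Module.Basis.constr_basis]
      simp [MvPolynomial.smul_monomial, mul_comm]
    rw [this, toExp_up β i hi, fact_prod β h i, ← mul_assoc]
    have e : ((toExp β i : ℕ) : K) = (β i : K) := by
      simp [toExp]
      rw [← Int.cast_natCast, Int.toNat_of_nonneg hi]
    rw [e, inv_mul_cancel₀, one_mul]
    have : (β i) + 1 ≠ 0 := by omega
    exact_mod_cast this
  · simp

lemma dOp_qm (β : Fin n → ℤ) (i : Fin n) :
    dOp K n i (qm K β) = qm K (β - Pi.single i 1) := by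
  obtain ⟨γ, rfl⟩ : ∃ γ, β = γ + Pi.single i 1 := ⟨β - Pi.single i 1, by simp⟩
  rw [add_sub_cancel_right]
  by_cases hi : 0 ≤ γ i
  · unfold qm
    rw [if_congr (nonneg_up γ i hi) rfl rfl]
    split_ifs with h
    · rw [toExp_up γ i hi, fact_prod γ h i]
      have e : ((toExp γ i : ℕ) : K) = (γ i : K) := by
        simp [toExp]
        rw [← Int.cast_natCast, Int.toNat_of_nonneg hi]
      simp [dOp, MvPolynomial.pderiv_monomial, e, mul_comm]
    · simp
  · rw [qm, qm, if_neg (c := ∀ j, 0 ≤ γ j) (fun h => hi (h i))]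
    split_ifs with h
    · have h2 := h i
      have : γ i = -1 := by simp at h2; omega
      simp [dOp, MvPolynomial.pderiv_monomial, toExp, this]
    · simp

lemma coeff_qm (β γ : Fin n → ℤ) (hγ : ∀ i, 0 ≤ γ i) (h : β ≠ γ) :
    MvPolynomial.coeff (toExp γ) (qm K β) = 0 := by
  unfold qm
  split_ifs with hb
  · rw [MvPolynomial.coeff_monomial, if_neg]
    intro e
    apply h
    funext i
    have := DFunLike.congr_fun e i
    simp [toExp] at this
    have := hb i; have := hγ i; omega
  · simp

lemma coeff_qm_self (γ : Fin n → ℤ) (hγ : ∀ i, 0 ≤ γ i) :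
    MvPolynomial.coeff (toExp γ) (qm K γ) ≠ 0 := by
  rw [qm, if_pos hγ, MvPolynomial.coeff_monomial, if_pos rfl, Finset.prod_ne_zero_iff]
  intro i _
  simp [Nat.factorial_ne_zero]

open scoped Classical in
/-- shift vector -/
def shv (m : Fin n → ℕ) : Fin n → ℤ := fun i => if i ∈ D then 0 else (m i : ℤ)

/-- specialization -/
def spm (m : Fin n → ℕ) : (Sx D →₀ MvPolynomial (Fin n) K) →ₗ[K] P K n :=
  Finsupp.lsum K fun α => (LinearMap.toSpanSingleton K (P K n) (qm K (α.1 + shv D m))).comp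
    (MvPolynomial.aeval (fun i => (m i : K) + 1) : MvPolynomial (Fin n) K →ₐ[K] K).toLinearMap

lemma spm_single (m : Fin n → ℕ) (α : Sx D) (f) : spm (K := K) D m (Finsupp.single α f) =
    MvPolynomial.aeval (fun i => (m i : K) + 1) f • qm K (α.1 + shv D m) := by
  rw [spm, Finsupp.lsum_single]; rfl

open scoped Classical in
variable (K) in
/-- generic weights -/
def tgen (i : Fin n) : MvPolynomial (Fin n) K := if i ∈ D then 1 else MvPolynomial.X i

open Filter

/-- asymptotic agreement -/
def Agr (T : Module.End K (P K n)) (T' : Module.End K (Sx D →₀ MvPolynomial (Fin n) K)) : Prop :=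
  ∀ v, ∀ᶠ m in atTop, T (spm D m v) = spm D m (T' v)

lemma agr_of_single {T : Module.End K (P K n)} {T' : Module.End K (Sx D →₀ MvPolynomial (Fin n) K)}
    (h : ∀ α f, ∀ᶠ m in atTop, T (spm D m (Finsupp.single α f)) = spm D m (T' (Finsupp.single α f))) :
    Agr D T T' := by
  intro v
  induction v using Finsupp.induction_linear with
  | zero => simp
  | add f g hf hg =>
    filter_upwards [hf, hg] with m h1 h2
    simp only [map_add, h1, h2]
  | single a b => exact h a b

lemma agr_d (i : Fin n) : Agr D (dOp K n i) (vd D i) := by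
  refine agr_of_single D fun α f => Eventually.of_forall fun m => ?_
  rw [spm_single, vd_single, map_smul, dOp_qm]
  split_ifs with h
  · rw [spm_single]
    congr 2
    simp only [Sx.down]
    abel
  · unfold Sx.can at h
    push Not at h
    rw [map_zero, qm, if_neg, smul_zero]
    intro hh
    have := hh i
    simp [shv, h.1] at this
    omega

lemma agr_i (i : Fin n) : Agr D (intOp K n i) (vi D i) := by
  refine agr_of_single D fun α f => ?_
  have : ∀ᶠ m : Fin n → ℕ in atTop, 0 ≤ (α.1 + shv D m) i := by
    filter_upwards [eventually_ge_atTop (fun _ => (-α.1 i).toNat)] with m hm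
    have h1 : (-α.1 i).toNat ≤ m i := hm i
    simp only [Pi.add_apply, shv]
    split_ifs with h
    · have := α.2 i h; omega
    · omega
  filter_upwards [this] with m hm
  rw [spm_single, vi_single, map_smul, intOp_qm _ _ hm, spm_single]
  congr 2
  simp only [Sx.up]
  abel

lemma agr_x (i : Fin n) : Agr D (xOp K n i) (vx D (tgen K D) i) := by
  refine agr_of_single D fun α f => Eventually.of_forall fun m => ?_
  rw [spm_single, vx_single, map_smul, xOp_qm, spm_single, smul_smul]
  congr 1
  · rw [map_mul, mul_comm]
    congr 1
    unfold tgen shv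
    by_cases h : i ∈ D
    · simp [h]; ring
    · simp [h]; ring
  · congr 1
    simp only [Sx.up]
    abel

lemma agr_zero {T'} (h : Agr (K := K) D 0 T') : T' = 0 := by
  refine LinearMap.ext fun v => ?_
  specialize h v
  simp only [LinearMap.zero_apply] at h ⊢
  generalize T' v = w at h
  refine Finsupp.ext fun α => ?_
  obtain ⟨N, hN⟩ := (h.and (eventually_ge_atTop (fun i => (-α.1 i).toNat))).exists_forall_of_atTop
  apply MvPolynomial.funext_set (fun i => (fun k : ℕ => (k : K) + 1) '' Set.Ici (N i))
  · intro i
    refine (Set.Ici_infinite _).image ?_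
    intro a _ b _ hab
    simpa using hab
  · intro x hx
    have : ∀ i, ∃ k : ℕ, N i ≤ k ∧ (k : K) + 1 = x i := fun i => hx i (Set.mem_univ i)
    choose m hm hmx using this
    obtain ⟨h1, h2⟩ := hN m hm
    obtain rfl : (fun i => (m i : K) + 1) = x := funext hmx
    have hnn : ∀ i, 0 ≤ (α.1 + shv D m) i := by
      intro i
      have h3 : (-α.1 i).toNat ≤ m i := h2 i
      simp only [Pi.add_apply, shv]
      split_ifs with h
      · have := α.2 i h; omega
      · omega
    have key : ∀ w, MvPolynomial.coeff (toExp (α.1 + shv D m)) (spm D m w) =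
        MvPolynomial.eval (fun i => (m i : K) + 1) (w α) *
          MvPolynomial.coeff (toExp (α.1 + shv D m)) (qm K (α.1 + shv D m)) := by
      intro w
      induction w using Finsupp.induction_linear with
      | zero => simp
      | add f g hf hg => simp only [map_add, MvPolynomial.coeff_add, hf, hg, Finsupp.add_apply, add_mul]
      | single β f =>
        rw [spm_single, MvPolynomial.coeff_smul, smul_eq_mul]
        by_cases hb : β = α
        · subst hb; simp
        · rw [coeff_qm _ _ hnn, Finsupp.single_eq_of_ne (Ne.symm hb)]
          · simp
          · intro e; exact hb (Subtype.ext (add_right_cancel e))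
    have := key w
    rw [← h1, MvPolynomial.coeff_zero] at this
    have := (mul_eq_zero.mp this.symm).resolve_right (coeff_qm_self _ hnn)
    simpa using this

/-- base change map -/
def bch : (Sx D →₀ MvPolynomial (Fin n) K) →ₗ[K] (Sx D →₀ R) :=
  Finsupp.mapRange.linearMap (MvPolynomial.aeval τ : MvPolynomial (Fin n) K →ₐ[K] R).toLinearMap

lemma bch_single (α : Sx D) (f) : bch (K := K) D τ (Finsupp.single α f) =
    Finsupp.single α (MvPolynomial.aeval τ f) := by
  simp [bch]

lemma exists_rep_V (hD : ∀ i ∈ D, τ i = 1) (hτ : Algebra.adjoin K (Set.range τ) = ⊤) :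
    ∃ ρ : In K n →ₐ[K] Module.End K (Sx D →₀ R), (∀ i, ρ (xEl K n i) = vx D τ i) ∧
      (∀ i, ρ (dEl K n i) = vd D i) ∧ (∀ i, ρ (intEl K n i) = vi D i) := by
  have hsurj : Function.Surjective (bch (K := K) D τ) := by
    have h1 : Function.Surjective (MvPolynomial.aeval τ : MvPolynomial (Fin n) K →ₐ[K] R) := by
      rw [← AlgHom.range_eq_top, ← Algebra.adjoin_range_eq_range_aeval, hτ]
    exact Finsupp.mapRange_surjective _ (map_zero _) h1
  let B : Subalgebra K (Module.End K (P K n) × Module.End K (Sx D →₀ R)) :=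
    { carrier := {T | ∃ T', Agr D T.1 T' ∧ ∀ v, T.2 (bch D τ v) = bch D τ (T' v)}
      add_mem' := by
        rintro a b ⟨A, hA, hA'⟩ ⟨B, hB, hB'⟩
        refine ⟨A + B, fun v => ?_, fun v => ?_⟩
        · filter_upwards [hA v, hB v] with m h1 h2
          simp [h1, h2]
        · simp [hA', hB']
      mul_mem' := by
        rintro a b ⟨A, hA, hA'⟩ ⟨B, hB, hB'⟩
        refine ⟨A * B, fun v => ?_, fun v => ?_⟩
        · filter_upwards [hA (B v), hB v] with m h1 h2
          simp [h1, h2]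
        · simp [hA', hB']
      algebraMap_mem' := by
        intro c
        refine ⟨algebraMap K _ c, fun v => Eventually.of_forall fun m => ?_, fun v => ?_⟩
        · simp [Module.algebraMap_end_apply]
        · simp [Module.algebraMap_end_apply] }
  have red : ∀ (T : Module.End K (Sx D →₀ R)) (T' : Module.End K (Sx D →₀ MvPolynomial (Fin n) K)),
      (∀ α f, T (bch D τ (Finsupp.single α f)) = bch D τ (T' (Finsupp.single α f))) →
      ∀ v, T (bch D τ v) = bch D τ (T' v) := by
    intro T T' h v
    induction v using Finsupp.induction_linear with
    | zero => simp
    | add f g hf hg => simp only [map_add, hf, hg]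
    | single a b => exact h a b
  refine exists_rep _ _ _ B ?_ ?_ ?_ ?_
  · intro i
    refine ⟨_, agr_x D i, red _ _ fun α f => ?_⟩
    rw [bch_single, vx_single, vx_single, bch_single]
    congr 1
    rw [map_mul]
    congr 1
    unfold tgen
    by_cases h : i ∈ D
    · simp [h, hD i h]
    · simp [h]
  · intro i
    refine ⟨_, agr_d D i, red _ _ fun α f => ?_⟩
    rw [bch_single, vd_single, vd_single]
    split_ifs
    · rw [bch_single]
    · simp
  · intro i
    refine ⟨_, agr_i D i, red _ _ fun α f => ?_⟩
    rw [bch_single, vi_single, vi_single, bch_single]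
  · rintro T ⟨T', hT, hT'⟩
    have := agr_zero D hT
    subst this
    refine LinearMap.ext fun w => ?_
    obtain ⟨v, rfl⟩ := hsurj w
    rw [hT']; simp

end
end PartA

noncomputable section PartB

/-- data of a module -/
structure Dat (K : Type u) [Field K] [CharZero K] (n : ℕ) where
  R : Type u
  [cr : CommRing R]
  [al : Algebra K R]
  D : Set (Fin n)
  mu : Fin n → K
  eps : R
  k : Fin n → K
  hD1 : ∀ i ∈ D, mu i = 1
  hD2 : ∀ i ∈ D, k i = 0
  hnil : IsNilpotent eps
  hgen : Algebra.adjoin K (Set.range fun i => algebraMap K R (mu i) + k i • eps) = ⊤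

attribute [instance] Dat.cr Dat.al

variable {K : Type u} [Field K] [CharZero K] {n : ℕ} (d : Dat K n)

/-- weights -/
def Dat.tau (i : Fin n) : d.R := algebraMap K d.R (d.mu i) + d.k i • d.eps

/-- the module -/
def V : Type u := Sx d.D →₀ d.R

instance : AddCommGroup (V d) := inferInstanceAs (AddCommGroup (Sx d.D →₀ d.R))
instance : Module K (V d) := inferInstanceAs (Module K (Sx d.D →₀ d.R))

lemma exists_rho : ∃ ρ : In K n →ₐ[K] Module.End K (V d), (∀ i, ρ (xEl K n i) = vx d.D d.tau i) ∧
      (∀ i, ρ (dEl K n i) = vd d.D i) ∧ (∀ i, ρ (intEl K n i) = vi d.D i) :=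
  exists_rep_V d.D d.tau (fun i hi => by simp [Dat.tau, d.hD1 i hi, d.hD2 i hi]) d.hgen

/-- action -/
def rho : In K n →ₐ[K] Module.End K (V d) := (exists_rho d).choose

instance : Module (In K n) (V d) := Module.compHom (V d) (rho d).toRingHom

lemma In_smul_V (a : In K n) (v : V d) : a • v = rho d a v := rfl

instance : IsScalarTower K (In K n) (V d) := ⟨fun c a v => by
  rw [In_smul_V, In_smul_V, map_smul, LinearMap.smul_apply]⟩

/-- basis-type element -/
def sg (α : Sx d.D) : d.R →ₗ[K] V d := Finsupp.lsingle α

/-- coefficient -/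
def cf (α : Sx d.D) : V d →ₗ[K] d.R := Finsupp.lapply α

lemma cf_sg_self (α : Sx d.D) (r) : cf d α (sg d α r) = r := Finsupp.single_eq_same

lemma cf_sg_ne {α β : Sx d.D} (h : α ≠ β) (r) : cf d α (sg d β r) = 0 := Finsupp.single_eq_of_ne h

lemma V_ext {v w : V d} (h : ∀ α, cf d α v = cf d α w) : v = w := Finsupp.ext h

lemma V_induct {C : V d → Prop} (h0 : C 0) (hadd : ∀ v w, C v → C w → C (v + w))
    (hs : ∀ α r, C (sg d α r)) (v) : C v :=
  Finsupp.induction_linear (motive := C) v h0 (fun f g => hadd f g) (fun a b => hs a b)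

lemma x_sg (i : Fin n) (α : Sx d.D) (r : d.R) :
    xEl K n i • sg d α r = sg d (α.up i) ((d.tau i + ((α.1 i : ℤ) : d.R)) * r) := by
  rw [In_smul_V, rho, (exists_rho d).choose_spec.1]; exact vx_single _ _ _ _ _

open scoped Classical in
lemma d_sg (i : Fin n) (α : Sx d.D) (r : d.R) :
    dEl K n i • sg d α r = if h : α.can i then sg d (α.down i h) r else 0 := by
  rw [In_smul_V, rho, (exists_rho d).choose_spec.2.1]; exact vd_single _ _ _ _

lemma i_sg (i : Fin n) (α : Sx d.D) (r : d.R) :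
    intEl K n i • sg d α r = sg d (α.up i) r := by
  rw [In_smul_V, rho, (exists_rho d).choose_spec.2.2]; exact vi_single _ _ _ _

lemma d_sg_up (i : Fin n) (α : Sx d.D) (r : d.R) :
    dEl K n i • sg d (α.up i) r = sg d α r := by
  rw [d_sg, dif_pos (α.up_can i), α.down_up i]

lemma H_sg (i : Fin n) (α : Sx d.D) (r : d.R) :
    HEl K n i • sg d α r = sg d α ((d.tau i + ((α.1 i : ℤ) : d.R)) * r) := by
  rw [HEl, mul_smul, x_sg, d_sg_up]

lemma cf_H (i : Fin n) (α : Sx d.D) (v : V d) :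
    cf d α (HEl K n i • v) = (d.tau i + ((α.1 i : ℤ) : d.R)) * cf d α v := by
  induction v using V_induct with
  | h0 => simp
  | hadd v w h1 h2 => simp only [smul_add, map_add, h1, h2, mul_add]
  | hs β r =>
    rw [H_sg]
    by_cases h : α = β
    · subst h; simp only [cf_sg_self]
    · simp only [cf_sg_ne d h, mul_zero]

lemma cf_Hpow (i : Fin n) (α : Sx d.D) (c : K) (N : ℕ) : ∀ (v : V d),
    cf d α ((HEl K n i - algebraMap K _ c) ^ N • v) =
      (d.tau i + ((α.1 i : ℤ) : d.R) - algebraMap K _ c) ^ N * cf d α v := by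
  induction N with
  | zero => simp
  | succ N ih =>
    intro v
    rw [pow_succ, mul_smul, ih, sub_smul, map_sub, cf_H, algebraMap_smul, map_smul, pow_succ,
      Algebra.smul_def]
    ring

lemma isUnit_aux (c : K) (hc : c ≠ 0) (k : K) : IsUnit (algebraMap K d.R c + k • d.eps) := by
  apply IsNilpotent.isUnit_add_left_of_commute (d.hnil.smul k) ((IsUnit.mk0 c hc).map _)
  exact Commute.all _ _

lemma tau_sub (i : Fin n) (z : ℤ) (c : K) : d.tau i + (z : d.R) - algebraMap K _ c =
    algebraMap K d.R (d.mu i + z - c) + d.k i • d.eps := by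
  simp [Dat.tau]; ring

lemma cf_eq_zero {i : Fin n} {α : Sx d.D} {c : K} {N : ℕ} {v : V d}
    (h : (HEl K n i - algebraMap K _ c) ^ N • v = 0) (hc : d.mu i + α.1 i - c ≠ 0) :
    cf d α v = 0 := by
  have := cf_Hpow d i α c N v
  rw [h, map_zero, tau_sub] at this
  exact (((isUnit_aux d _ hc _).pow N).mul_right_eq_zero).mp this.symm

lemma exists_eps : ∃ s : ℕ, d.eps ^ s = 0 := d.hnil

lemma Hpow_sg (s : ℕ) (hs : d.eps ^ s = 0) (i : Fin n) (α : Sx d.D) (v : V d) :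
    cf d α ((HEl K n i - algebraMap K _ (d.mu i + α.1 i)) ^ s • v) = 0 := by
  rw [cf_Hpow, tau_sub, sub_self, map_zero, zero_add, smul_pow, hs]; simp

/-! ### submodules -/
variable {d} (W : Submodule (In K n) (V d))

lemma K_smul_mem (c : K) {v : V d} (h : v ∈ W) : c • v ∈ W := by
  rw [← algebraMap_smul (In K n) c v]; exact W.smul_mem _ h

lemma tau_mem {α : Sx d.D} {r : d.R} (h : sg d α r ∈ W) (i : Fin n) :
    sg d α (d.tau i * r) ∈ W := by
  have h1 := W.smul_mem (HEl K n i) h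
  rw [H_sg, add_mul, map_add] at h1
  have h2 := K_smul_mem W ((α.1 i : ℤ) : K) h
  rw [← map_smul, Algebra.smul_def, map_intCast] at h2
  simpa using W.sub_mem h1 h2

lemma R_mem {α : Sx d.D} {r : d.R} (h : sg d α r ∈ W) (a : d.R) : sg d α (a * r) ∈ W := by
  have ha : a ∈ Algebra.adjoin K (Set.range d.tau) := by
    have := d.hgen
    change Algebra.adjoin K (Set.range d.tau) = ⊤ at this
    rw [this]; trivial
  induction ha using Algebra.adjoin_induction generalizing r with
  | mem x hx => obtain ⟨i, rfl⟩ := hx; exact tau_mem W h i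
  | algebraMap c => rw [← Algebra.smul_def, map_smul]; exact K_smul_mem W c h
  | add x y _ _ h1 h2 => rw [add_mul, map_add]; exact W.add_mem (h1 h) (h2 h)
  | mul x y _ _ h1 h2 => rw [mul_assoc]; exact h1 (h2 h)

lemma up_mem {α : Sx d.D} {r : d.R} (i : Fin n) : sg d (α.up i) r ∈ W ↔ sg d α r ∈ W := by
  constructor
  · intro h
    have := W.smul_mem (dEl K n i) h
    rwa [d_sg_up] at this
  · intro h
    have := W.smul_mem (intEl K n i) h
    rwa [i_sg] at this

lemma le_mem_aux (N : ℕ) : ∀ {α β : Sx d.D} (r : d.R), (∀ i, α.1 i ≤ β.1 i) →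
    ∑ i, (β.1 i - α.1 i) = N → (sg d β r ∈ W ↔ sg d α r ∈ W) := by
  induction N with
  | zero =>
    intro α β r hle hs
    have : α = β := by
      apply Subtype.ext
      funext i
      have := (Finset.sum_eq_zero_iff_of_nonneg (fun i _ => sub_nonneg.mpr (hle i))).mp
        (by simpa using hs) i (Finset.mem_univ i)
      omega
    rw [this]
  | succ N ih =>
    intro α β r hle hs
    obtain ⟨i, hi⟩ : ∃ i, α.1 i < β.1 i := by
      by_contra hcon
      push Not at hcon
      have : ∑ i, (β.1 i - α.1 i) ≤ 0 := Finset.sum_nonpos fun i _ => by have := hcon i; omega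
      omega
    rw [← up_mem W (α := α) i]
    apply ih
    · intro j
      by_cases hj : j = i
      · subst hj; simp [Sx.up]; omega
      · simp [Sx.up, hj, hle j]
    · have : ∑ j, (β.1 j - (α.up i).1 j) = ∑ j, (β.1 j - α.1 j) - ∑ j, (Pi.single i 1 : Fin n → ℤ) j := by
        rw [← Finset.sum_sub_distrib]
        refine Finset.sum_congr rfl fun j _ => ?_
        simp [Sx.up]; ring
      rw [this, hs]; simp

lemma all_mem {α : Sx d.D} {r : d.R} (h : sg d α r ∈ W) (β : Sx d.D) : sg d β r ∈ W := by
  let γ : Sx d.D := ⟨fun i => max (α.1 i) (β.1 i), fun i hi => le_max_of_le_left (α.2 i hi)⟩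
  have h1 : ∀ δ : Sx d.D, (∀ i, δ.1 i ≤ γ.1 i) → (sg d γ r ∈ W ↔ sg d δ r ∈ W) := by
    intro δ hδ
    obtain ⟨N, hN⟩ := Int.eq_ofNat_of_zero_le
      (Finset.sum_nonneg (fun i (_ : i ∈ Finset.univ) => sub_nonneg.mpr (hδ i)))
    exact le_mem_aux W N r hδ hN
  exact (h1 β fun i => le_max_right _ _).mp ((h1 α fun i => le_max_left _ _).mpr h)

lemma cf_mem_aux (N : ℕ) : ∀ (w : V d) (α : Sx d.D), w ∈ W →
    ({β | cf d β w ≠ 0} : Set _).ncard ≤ N → ({β | cf d β w ≠ 0} : Set _).Finite →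
    sg d α (cf d α w) ∈ W := by
  induction N with
  | zero =>
    intro w α hw h hf
    have h0 : ({β | cf d β w ≠ 0} : Set _) = ∅ := (Set.ncard_eq_zero hf).mp (by omega)
    have : cf d α w = 0 := by
      by_contra hc
      have : α ∈ ({β | cf d β w ≠ 0} : Set _) := hc
      rw [h0] at this; exact this
    rw [this, map_zero]; exact W.zero_mem
  | succ N ih =>
    intro w α hw h hf
    by_cases hex : ∃ β, β ≠ α ∧ cf d β w ≠ 0
    · obtain ⟨β, hb, hbw⟩ := hex
      obtain ⟨i, hi⟩ : ∃ i, β.1 i ≠ α.1 i := by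
        by_contra hcon; push Not at hcon; exact hb (Subtype.ext (funext hcon))
      obtain ⟨s, hs⟩ := exists_eps d
      have hsub : ({γ | cf d γ ((HEl K n i - algebraMap K _ (d.mu i + β.1 i)) ^ s • w) ≠ 0} : Set _)
          ⊆ ({γ | cf d γ w ≠ 0} : Set _) \ {β} := by
        intro γ hγ
        refine ⟨?_, ?_⟩
        · intro hz; apply hγ; rw [cf_Hpow, hz, mul_zero]
        · rintro rfl
          exact hγ (Hpow_sg d s hs i _ w)
      have h1 := ih _ α (W.smul_mem ((HEl K n i - algebraMap K _ (d.mu i + β.1 i)) ^ s) hw) ?_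
        ((hf.diff).subset hsub)
      · rw [cf_Hpow, tau_sub] at h1
        have hu : IsUnit (algebraMap K d.R (d.mu i + α.1 i - (d.mu i + β.1 i)) + d.k i • d.eps) := by
          apply isUnit_aux
          rw [add_sub_add_left_eq_sub, sub_ne_zero]
          exact_mod_cast hi.symm
        obtain ⟨b, hb⟩ := (hu.pow s).exists_left_inv
        have := R_mem W h1 b
        rwa [← mul_assoc, hb, one_mul] at this
      · have := Set.ncard_le_ncard hsub hf.diff
        have h3 := Set.ncard_diff_singleton_add_one (a := β) hbw hf
        omega
    · push Not at hex
      have : w = sg d α (cf d α w) := by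
        apply V_ext
        intro β
        by_cases hb : β = α
        · subst hb; rw [cf_sg_self]
        · rw [hex β hb, cf_sg_ne d hb]
      rwa [← this]

lemma cf_finite (w : V d) : ({β | cf d β w ≠ 0} : Set _).Finite :=
  (Finsupp.finite_support (w : Sx d.D →₀ d.R))

lemma cf_mem {w : V d} (hw : w ∈ W) (α β : Sx d.D) : sg d β (cf d α w) ∈ W :=
  all_mem W (cf_mem_aux W _ w α hw le_rfl (cf_finite w)) β

lemma mem_of_cf {w : V d} (hw : ∀ α, sg d α (cf d α w) ∈ W) : w ∈ W := by
  have : w = ∑ α ∈ (cf_finite w).toFinset, sg d α (cf d α w) := by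
    apply V_ext
    intro β
    rw [map_sum]
    by_cases hb : cf d β w = 0
    · rw [hb, Finset.sum_eq_zero]
      intro α ha
      apply cf_sg_ne
      rintro rfl
      simp at ha; exact ha hb
    · rw [Finset.sum_eq_single β, cf_sg_self]
      · intro α _ hα; exact cf_sg_ne d hα.symm _
      · intro h; exact absurd ((cf_finite w).mem_toFinset.mpr hb) h
  rw [this]
  exact W.sum_mem fun α _ => hw α

/-- origin -/
def org (d : Dat K n) : Sx d.D := ⟨0, fun _ _ => le_rfl⟩

/-- constant-coefficient data -/
@[reducible] def Dat.ofK (D : Set (Fin n)) (mu : Fin n → K) (h : ∀ i ∈ D, mu i = 1) : Dat K n where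
  R := K
  D := D
  mu := mu
  eps := 0
  k := 0
  hD1 := h
  hD2 := fun _ _ => rfl
  hnil := IsNilpotent.zero
  hgen := by
    rw [eq_top_iff]
    intro x _
    exact Subalgebra.algebraMap_mem _ x

section ofK
variable (D : Set (Fin n)) (mu : Fin n → K) (h : ∀ i ∈ D, mu i = 1)

/-- basis -/
def vb : Module.Basis (Sx D) K (V (Dat.ofK D mu h)) :=
  (Finsupp.basisSingleOne : Module.Basis (Sx D) K (Sx D →₀ K))

lemma vb_eq (α : Sx D) : vb D mu h α = sg (Dat.ofK D mu h) α (1 : K) :=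
  congrFun (Finsupp.coe_basisSingleOne (R := K) (ι := Sx D)) α

lemma vb_repr (α : Sx D) (v) : (vb D mu h).repr v α = cf (Dat.ofK D mu h) α v := rfl

lemma ofK_tau (i : Fin n) : (Dat.ofK D mu h).tau i = mu i := by
  have : (Dat.ofK D mu h).tau i = (algebraMap K K (mu i) + (0 : K) • (0 : K) : K) := rfl
  rw [this]; simp

lemma x_vb (i : Fin n) (α : Sx D) :
    xEl K n i • vb D mu h α = (mu i + ((α.1 i : ℤ) : K)) • vb D mu h (α.up i) := by
  rw [vb_eq, x_sg, ofK_tau, vb_eq, ← map_smul]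
  congr 1

open scoped Classical in
lemma d_vb (i : Fin n) (α : Sx D) :
    dEl K n i • vb D mu h α = if h' : α.can i then vb D mu h (α.down i h') else 0 := by
  rw [vb_eq, d_sg]; simp only [vb_eq]

lemma i_vb (i : Fin n) (α : Sx D) :
    intEl K n i • vb D mu h α = vb D mu h (α.up i) := by
  rw [vb_eq, i_sg, vb_eq]

open scoped Classical in
lemma exists_lin {M : Type*} [AddCommGroup M] [Module K M] [Module (In K n) M]
    [IsScalarTower K (In K n) M] (g : Sx D → M)
    (hx : ∀ i α, xEl K n i • g α = (mu i + ((α.1 i : ℤ) : K)) • g (α.up i))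
    (hd : ∀ i α, dEl K n i • g α = if h' : α.can i then g (α.down i h') else 0)
    (hi : ∀ i α, intEl K n i • g α = g (α.up i)) :
    ∃ f : V (Dat.ofK D mu h) →ₗ[In K n] M, ∀ α, f (vb D mu h α) = g α := by
  let f0 := (vb D mu h).constr K g
  have hf0 : ∀ α, f0 (vb D mu h α) = g α := fun α => Module.Basis.constr_basis _ _ _ _
  have key : ∀ a : In K n, (∀ α, f0 (a • vb D mu h α) = a • g α) → ∀ v, f0 (a • v) = a • f0 v := by
    intro a ha v
    have : f0 ∘ₗ (Algebra.lsmul K K (V (Dat.ofK D mu h)) a) = (Algebra.lsmul K K M a) ∘ₗ f0 := by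
      apply (vb D mu h).ext
      intro α
      simp only [LinearMap.comp_apply, Algebra.lsmul_coe, ha, hf0]
    exact LinearMap.congr_fun this v
  refine ⟨mkIn f0 ?_ ?_ ?_, hf0⟩
  · intro i; apply key; intro α; rw [x_vb, map_smul, hf0, hx]
  · intro i; apply key; intro α; rw [d_vb, hd]; split_ifs
    · rw [hf0]
    · rw [map_zero]
  · intro i; apply key; intro α; rw [i_vb, hf0, hi]

instance ofK_simple : IsSimpleModule (In K n) (V (Dat.ofK D mu h)) where
  exists_pair_ne := by
    refine ⟨⊥, ⊤, fun h' => ?_⟩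
    have := (vb D mu h).ne_zero (org (Dat.ofK D mu h))
    exact this ((Submodule.mem_bot (In K n)).mp (h' ▸ trivial))
  eq_bot_or_eq_top := by
    intro W
    by_contra hcon
    push Not at hcon
    obtain ⟨h1, h2⟩ := hcon
    obtain ⟨w, hw, hw0⟩ := W.ne_bot_iff.mp h1
    obtain ⟨α, hα⟩ : ∃ α, cf (Dat.ofK D mu h) α w ≠ 0 := by
      by_contra hc; push Not at hc
      exact hw0 (V_ext _ fun α => by rw [hc, map_zero])
    apply h2
    rw [eq_top_iff]
    intro v _
    apply mem_of_cf
    intro β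
    have := R_mem W (cf_mem W hw α β) ((cf (Dat.ofK D mu h) β v : K) * (cf (Dat.ofK D mu h) α w : K)⁻¹ : K)
    convert this using 2
    exact (inv_mul_cancel_right₀ (G₀ := K) hα _).symm

end ofK

open scoped Classical in
/-- bottom: simple subquotients -/
lemma subquot (p q : Submodule (In K n) (V d))
    (hs : IsSimpleModule (In K n) (q ⧸ Submodule.comap q.subtype p)) :
    Nonempty (V (Dat.ofK d.D d.mu d.hD1) ≃ₗ[In K n] (q ⧸ Submodule.comap q.subtype p)) := by
  have : ∃ c : d.R, (∀ α, sg d α c ∈ q) ∧ sg d (org d) c ∉ p := by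
    by_contra hcon
    push Not at hcon
    have hle : q ≤ p := by
      intro w hw
      apply mem_of_cf
      intro α
      exact all_mem p (hcon _ fun β => cf_mem q hw α β) α
    have htop : Submodule.comap q.subtype p = ⊤ := by
      rw [eq_top_iff]; intro x _; exact hle x.2
    have := hs.nontrivial
    exact absurd htop (Submodule.Quotient.nontrivial_iff.mp this)
  obtain ⟨c0, hc0, hc0'⟩ := this
  have : ∃ c : d.R, (∀ α, sg d α c ∈ q) ∧ sg d (org d) c ∉ p ∧ ∀ α, sg d α (d.eps * c) ∈ p := by
    have hex : ∃ N, sg d (org d) (d.eps ^ N * c0) ∈ p := by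
      obtain ⟨s, hs⟩ := exists_eps d
      exact ⟨s, by rw [hs, zero_mul, map_zero]; exact p.zero_mem⟩
    have h1 := Nat.find_spec hex
    obtain ⟨N, hN⟩ : ∃ N, Nat.find hex = N + 1 := by
      apply Nat.exists_eq_succ_of_ne_zero
      intro h0
      rw [h0, pow_zero, one_mul] at h1
      exact hc0' h1
    have h2 : ¬ _ := Nat.find_min hex (m := N) (by omega)
    rw [hN, pow_succ', mul_assoc] at h1
    exact ⟨d.eps ^ N * c0, fun α => R_mem q (hc0 α) _, h2, fun α => all_mem p h1 α⟩
  obtain ⟨c, hc, hc', hc''⟩ := this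
  obtain ⟨f, hf⟩ := exists_lin d.D d.mu d.hD1
    (M := q ⧸ Submodule.comap q.subtype p) (fun α => Submodule.Quotient.mk ⟨sg d α c, hc α⟩) (by
      intro i α
      rw [← Submodule.Quotient.mk_smul, ← algebraMap_smul (In K n), ← Submodule.Quotient.mk_smul,
        Submodule.Quotient.eq]
      show xEl K n i • sg d α c - algebraMap K (In K n) _ • sg d _ _ ∈ p
      rw [x_sg, algebraMap_smul, ← map_smul, ← map_sub]
      have e : (d.tau i + ((α.1 i : ℤ) : d.R)) * c - (d.mu i + ((α.1 i : ℤ) : K)) • c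
         = algebraMap K d.R (d.k i) * (d.eps * c) := by
        simp only [Dat.tau, Algebra.smul_def, map_add, map_intCast]
        ring
      rw [e]
      exact R_mem p (hc'' _) _) (by
      intro i α
      rw [← Submodule.Quotient.mk_smul]
      split_ifs with h
      · congr 1
        apply Subtype.ext
        show dEl K n i • sg d α _ = sg d _ _
        rw [d_sg, dif_pos h]
      · rw [Submodule.Quotient.mk_eq_zero]
        show dEl K n i • sg d α _ ∈ p
        rw [d_sg, dif_neg h]; exact p.zero_mem) (by
      intro i α
      rw [← Submodule.Quotient.mk_smul]
      congr 1
      apply Subtype.ext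
      show intEl K n i • sg d α _ = sg d _ _
      rw [i_sg])
  have hne : f ≠ 0 := by
    intro h0
    have h2 := hf (org d)
    rw [h0, LinearMap.zero_apply, eq_comm, Submodule.Quotient.mk_eq_zero] at h2
    exact hc' h2
  exact ⟨LinearEquiv.ofBijective f (LinearMap.bijective_of_ne_zero hne)⟩

end PartB

noncomputable section PartC

variable {K : Type u} [Field K] [CharZero K] {n : ℕ}

lemma monomial_qm (β : Fin n →₀ ℕ) (c : K) : ∃ c' : K,
    MvPolynomial.monomial β c = c' • qm K (fun i => (β i : ℤ)) := by
  have h : toExp (fun i => (β i : ℤ)) = β := by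
    ext i; simp [toExp]
  rw [qm, if_pos (fun i => by positivity), h]
  have h0 : (∏ i, ((((β i : ℤ).toNat).factorial : K))⁻¹) ≠ 0 := by
    rw [Finset.prod_ne_zero_iff]; intro i _; simp [Nat.factorial_ne_zero]
  refine ⟨c * (∏ i, ((((β i : ℤ).toNat).factorial : K))⁻¹)⁻¹, ?_⟩
  rw [MvPolynomial.smul_monomial, smul_eq_mul, mul_assoc, inv_mul_cancel₀ h0, mul_one]

variable (K n) in
/-- the polynomial module as `V` -/
abbrev VP : Type u := V (Dat.ofK (K := K) (n := n) Set.univ 1 (fun _ _ => rfl))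

variable (K n) in
/-- basis of it -/
abbrev pb : Module.Basis (Sx (Set.univ : Set (Fin n))) K (VP K n) :=
  vb Set.univ 1 (fun _ _ => rfl)

lemma P_iso : ∃ f : VP K n ≃ₗ[In K n] P K n, ∀ α, f (pb K n α) = qm K α.1 := by
  classical
  obtain ⟨f, hf⟩ := exists_lin (K := K) (n := n) Set.univ 1 (fun _ _ => rfl)
    (fun α => qm K α.1) (by
      intro i α
      have := xOp_qm (K := K) α.1 i
      rw [add_comm] at this
      exact this) (by
      intro i α
      have := dOp_qm (K := K) α.1 i
      split_ifs with h
      · exact this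
      · refine this.trans ?_
        rw [qm, if_neg]
        intro h2
        apply h
        intro _
        have := h2 i
        simp at this; omega) (by
      intro i α
      exact intOp_qm (K := K) α.1 i (α.2 i trivial))
  have hne : f ≠ 0 := by
    intro h0
    have h1 := hf ⟨0, fun _ _ => le_rfl⟩
    have h2 := coeff_qm_self (K := K) (0 : Fin n → ℤ) (fun _ => le_rfl)
    rw [h0, LinearMap.zero_apply] at h1
    apply h2
    rw [show qm K (0 : Fin n → ℤ) = 0 from h1.symm, MvPolynomial.coeff_zero]
  have hinj : Function.Injective f := LinearMap.injective_of_ne_zero hne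
  have hsurj : Function.Surjective f := by
    rw [← LinearMap.range_eq_top, eq_top_iff]
    rintro p -
    induction p using MvPolynomial.monomial_add_induction_on with
    | C a =>
      obtain ⟨c', hc⟩ := monomial_qm (0 : Fin n →₀ ℕ) a
      rw [show MvPolynomial.C a = MvPolynomial.monomial 0 a from rfl, hc]
      refine ⟨c' • pb K n ⟨fun i => ((0 : Fin n →₀ ℕ) i : ℤ), fun _ _ => by positivity⟩, ?_⟩
      rw [LinearMap.map_smul_of_tower, hf]
    | monomial_add β a p _ _ ih =>
      refine Submodule.add_mem _ ?_ ih
      obtain ⟨c', hc⟩ := monomial_qm β a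
      rw [hc]
      refine ⟨c' • pb K n ⟨fun i => (β i : ℤ), fun _ _ => by positivity⟩, ?_⟩
      rw [LinearMap.map_smul_of_tower, hf]
  exact ⟨LinearEquiv.ofBijective f ⟨hinj, hsurj⟩, hf⟩

instance P_simple : IsSimpleModule (In K n) (P K n) := by
  obtain ⟨f, -⟩ := P_iso (K := K) (n := n)
  exact IsSimpleModule.congr f.symm

lemma in_ext_pb {a b : In K n} (h : ∀ α, a • pb K n α = b • pb K n α) : a = b := by
  apply in_ext'
  obtain ⟨f, -⟩ := P_iso (K := K) (n := n)
  have key : ∀ v : VP K n, a • v = b • v := by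
    intro v
    have : (Algebra.lsmul K K (VP K n) a) = (Algebra.lsmul K K (VP K n) b) :=
      (pb K n).ext h
    exact LinearMap.congr_fun this v
  intro p
  obtain ⟨v, rfl⟩ := f.surjective p
  rw [← map_smul, ← map_smul, key]

lemma d_i_one (i : Fin n) : dEl K n i * intEl K n i = 1 := by
  apply in_ext_pb
  intro α
  rw [mul_smul, i_vb, d_vb, dif_pos (α.up_can i), α.down_up, one_smul]

lemma H_vb (D : Set (Fin n)) (mu : Fin n → K) (h) (i : Fin n) (α : Sx D) :
    HEl K n i • vb D mu h α = (mu i + ((α.1 i : ℤ) : K)) • vb D mu h α := by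
  rw [HEl, mul_smul, x_vb, smul_comm, d_vb, dif_pos (α.up_can i), α.down_up]

lemma x_eq_iH (i : Fin n) : xEl K n i = intEl K n i * HEl K n i := by
  apply in_ext_pb
  intro α
  rw [mul_smul, H_vb, x_vb, smul_comm, i_vb]

lemma sub_one_smul' {M : Type*} [AddCommGroup M] [Module K M] (c : K) (v : M) :
    (c - 1) • v = c • v - v := by rw [sub_smul, one_smul]

lemma add_one_smul' {M : Type*} [AddCommGroup M] [Module K M] (c : K) (v : M) :
    (c + 1) • v = c • v + v := by rw [add_smul, one_smul]

lemma H_d (i : Fin n) : HEl K n i * dEl K n i = dEl K n i * (HEl K n i - 1) := by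
  apply in_ext_pb
  intro α
  rw [mul_smul, mul_smul, sub_smul, H_vb, one_smul, smul_sub, smul_comm (dEl K n i), d_vb]
  split_ifs with h
  · rw [H_vb, ← sub_one_smul']
    congr 1
    simp [Sx.down]
  · simp

lemma H_i (i : Fin n) : HEl K n i * intEl K n i = intEl K n i * (HEl K n i + 1) := by
  apply in_ext_pb
  intro α
  rw [mul_smul, mul_smul, add_smul, H_vb, one_smul, smul_add, smul_comm (intEl K n i), i_vb]
  rw [H_vb, ← add_one_smul']
  congr 1
  simp [Sx.up]
  ring

/-! ### one variable -/

lemma i_d_empty (mu : Fin n → K) (h) (i : Fin n) (v : V (Dat.ofK (∅ : Set (Fin n)) mu h)) :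
    intEl K n i • dEl K n i • v = v := by
  have : (Algebra.lsmul K K _ (intEl K n i)) ∘ₗ (Algebra.lsmul K K _ (dEl K n i)) =
    (LinearMap.id : V (Dat.ofK (∅ : Set (Fin n)) mu h) →ₗ[K] _) := by
    apply (vb ∅ mu h).ext
    intro α
    have hc : α.can i := fun h => absurd h (Set.notMem_empty i)
    simp only [LinearMap.comp_apply, Algebra.lsmul_coe, LinearMap.id_apply]
    rw [d_vb, dif_pos hc, i_vb, α.up_down]
  exact LinearMap.congr_fun this v

/-- generator -/
def um (mu : K) : Msl K 1 mu := Submodule.Quotient.mk (1 : In K 1)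

lemma um_ne (mu : K) : um mu ≠ 0 := by
  intro h0
  have h1 : (1 : In K 1) ∈ MslIdeal K 1 mu := (Submodule.Quotient.mk_eq_zero _).mp h0
  let W := V (Dat.ofK (∅ : Set (Fin 1)) (fun _ => mu) (fun i h => absurd h (Set.notMem_empty i)))
  let b : Module.Basis _ K W := vb (∅ : Set (Fin 1)) (fun _ => mu) (fun i h => absurd h (Set.notMem_empty i))
  let o : Sx (∅ : Set (Fin 1)) := ⟨0, fun _ _ => le_rfl⟩
  have h2 : MslIdeal K 1 mu ≤ LinearMap.ker (LinearMap.toSpanSingleton (In K 1) W (b o)) := by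
    refine sup_le (Submodule.span_le.mpr ?_) (Submodule.span_le.mpr ?_)
    · rintro _ ⟨s, t, rfl⟩
      simp only [SetLike.mem_coe, LinearMap.mem_ker, LinearMap.toSpanSingleton_apply]
      rw [eEl1, sub_smul, pow_succ (intEl K 1 0), pow_succ' (dEl K 1 0), mul_assoc,
        mul_smul, mul_smul, mul_smul, mul_smul, i_d_empty, sub_self]
    · rintro _ rfl
      simp only [SetLike.mem_coe, LinearMap.mem_ker, LinearMap.toSpanSingleton_apply]
      rw [pow_one, sub_smul, algebraMap_smul, H_vb]
      simp [o, b]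
  have h3 := h2 h1
  simp only [LinearMap.mem_ker, LinearMap.toSpanSingleton_apply, one_smul] at h3
  exact b.ne_zero o h3

lemma um_H (mu : K) : HEl K 1 0 • um mu = mu • um mu := by
  rw [← sub_eq_zero, ← algebraMap_smul (In K 1) mu, ← sub_smul]
  refine (Submodule.Quotient.mk_eq_zero _).mpr ?_
  apply Submodule.mem_sup_right
  beta_reduce
  rw [smul_eq_mul, mul_one]
  apply Submodule.subset_span
  simp

lemma um_id (mu : K) (t : ℕ) : intEl K 1 0 • dEl K 1 0 ^ (t + 1) • um mu = dEl K 1 0 ^ t • um mu := by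
  rw [eq_comm, ← sub_eq_zero, ← mul_smul, ← sub_smul]
  refine (Submodule.Quotient.mk_eq_zero _).mpr ?_
  apply Submodule.mem_sup_left
  beta_reduce
  rw [smul_eq_mul, mul_one]
  apply Submodule.subset_span
  exact ⟨0, t, by simp [eEl1]⟩

lemma um_Hd (mu : K) (t : ℕ) : HEl K 1 0 • dEl K 1 0 ^ t • um mu = (mu - t) • dEl K 1 0 ^ t • um mu := by
  induction t with
  | zero => simp [um_H]
  | succ t ih =>
    rw [pow_succ', mul_smul, ← mul_smul (HEl K 1 0), H_d, mul_smul, sub_smul, ih, one_smul,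
      ← sub_one_smul', smul_comm]
    congr 1; push_cast; ring

lemma um_Hi (mu : K) (t : ℕ) : HEl K 1 0 • intEl K 1 0 ^ t • um mu = (mu + t) • intEl K 1 0 ^ t • um mu := by
  induction t with
  | zero => simp [um_H]
  | succ t ih =>
    rw [pow_succ', mul_smul, ← mul_smul (HEl K 1 0), H_i, mul_smul, add_smul, ih, one_smul]
    rw [← add_one_smul', smul_comm]
    congr 1; push_cast; ring

/-- powers -/
def ug (mu : K) : ℤ → Msl K 1 mu
  | Int.ofNat t => intEl K 1 0 ^ t • um mu
  | Int.negSucc t => dEl K 1 0 ^ (t + 1) • um mu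

lemma ug_H (mu : K) (k : ℤ) : HEl K 1 0 • ug mu k = (mu + k) • ug mu k := by
  cases k with
  | ofNat t => simp only [ug, um_Hi]; simp
  | negSucc t => simp only [ug, um_Hd]; congr 1; push_cast; ring

lemma ug_d (mu : K) (k : ℤ) : dEl K 1 0 • ug mu k = ug mu (k - 1) := by
  rcases k with (_ | t) | t
  · show _ = ug mu (Int.negSucc 0)
    simp [ug]
  · have : Int.ofNat (t + 1) - 1 = Int.ofNat t := by simp
    rw [this]
    simp only [ug]
    rw [pow_succ', mul_smul, ← mul_smul, d_i_one, one_smul]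
  · have : Int.negSucc t - 1 = Int.negSucc (t + 1) := by omega
    rw [this]
    simp only [ug]
    rw [← mul_smul, ← pow_succ']

lemma ug_i (mu : K) (k : ℤ) : intEl K 1 0 • ug mu k = ug mu (k + 1) := by
  rcases k with t | _ | t
  · have : Int.ofNat t + 1 = Int.ofNat (t + 1) := rfl
    rw [this]
    simp only [ug]
    rw [← mul_smul, ← pow_succ']
  · show _ = ug mu (Int.ofNat 0)
    simp only [ug, um_id, pow_zero]
  · have : Int.negSucc (t + 1) + 1 = Int.negSucc t := by omega
    rw [this]
    simp only [ug, um_id]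

lemma Msl_iso (mu : Fin 1 → K) (h) :
    Nonempty (V (Dat.ofK (∅ : Set (Fin 1)) mu h) ≃ₗ[In K 1] Msl K 1 (mu 0)) := by
  classical
  obtain ⟨f, hf⟩ := exists_lin ∅ mu h (fun α => ug (mu 0) (α.1 0)) (by
      intro i α
      obtain rfl : i = 0 := Subsingleton.elim _ _
      rw [x_eq_iH, mul_smul, ug_H, smul_comm, ug_i]; simp [Sx.up]) (by
      intro i α
      obtain rfl : i = 0 := Subsingleton.elim _ _
      have hc : α.can 0 := fun h => absurd h (Set.notMem_empty _)
      rw [dif_pos hc, ug_d]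
      simp [Sx.down]) (by
      intro i α
      obtain rfl : i = 0 := Subsingleton.elim _ _
      rw [ug_i]; simp [Sx.up])
  have h0 : f (vb ∅ mu h ⟨0, fun _ _ => le_rfl⟩) = um (mu 0) := by
    rw [hf]; show ug (mu 0) (Int.ofNat 0) = _; simp [ug]
  have hne : f ≠ 0 := by
    rintro rfl
    exact um_ne (mu 0) h0.symm
  refine ⟨LinearEquiv.ofBijective f ⟨LinearMap.injective_of_ne_zero hne, ?_⟩⟩
  intro y
  obtain ⟨a, rfl⟩ := Submodule.Quotient.mk_surjective _ y
  refine ⟨a • vb ∅ mu h ⟨0, fun _ _ => le_rfl⟩, ?_⟩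
  rw [map_smul, h0, um]
  show Submodule.Quotient.mk (a • (1 : In K 1)) = _
  rw [smul_eq_mul, mul_one]

end PartC

noncomputable section PartD

variable {K : Type u} [Field K] [CharZero K] {n : ℕ}

lemma tprodMap_tprod (Mi : Fin n → ModN K 1) (i : Fin n) (a : In K 1)
    (m : ∀ j, (Mi j).carrier) : tprodMap K n Mi i a (PiTensorProduct.tprod K m) =
      PiTensorProduct.tprod K (Function.update m i (a • m i)) := by
  rw [tprodMap, PiTensorProduct.map_tprod]
  congr 1
  funext j
  by_cases hj : j = i
  · subst hj; simp; rfl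
  · simp [hj]

lemma RealizesMD.congr {lam : Fin n → K} {D : Set (Fin n)} {M N : Type*}
    [AddCommGroup M] [Module K M] [Module (In K n) M] [IsScalarTower K (In K n) M]
    [AddCommGroup N] [Module K N] [Module (In K n) N] [IsScalarTower K (In K n) N]
    (e : M ≃ₗ[In K n] N) (h : RealizesMD K n lam D M) : RealizesMD K n lam D N := by
  obtain ⟨Mi, h1, h2, φ, hφ⟩ := h
  refine ⟨Mi, h1, h2, (e.symm.restrictScalars K).trans φ, ?_⟩
  intro i m
  have := hφ i (e.symm m)
  rw [← map_smul, ← map_smul, ← map_smul] at this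
  exact this

section
variable (D : Set (Fin n)) (mu : Fin n → K) (h : ∀ i ∈ D, mu i = 1)

/-- one-dimensional index -/
def D1 (i : Fin n) : Set (Fin 1) := {_j | i ∈ D}

lemma hD1 (D : Set (Fin n)) (mu : Fin n → K) (h : ∀ i ∈ D, mu i = 1) (i : Fin n) : ∀ j ∈ D1 D i, (fun _ => mu i : Fin 1 → K) j = 1 := fun _ hj => h i hj

/-- factors -/
@[reducible] def factor (i : Fin n) : ModN K 1 where
  carrier := V (Dat.ofK (D1 D i) (fun _ => mu i) (hD1 D mu h i))

/-- basis of a factor -/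
def fb (i : Fin n) : Module.Basis (Sx (D1 D i)) K (factor D mu h i).carrier :=
  vb (D1 D i) (fun _ => mu i) (hD1 D mu h i)

/-- index equivalence -/
def splitE : Sx D ≃ ∀ i, Sx (D1 D i) where
  toFun α i := ⟨fun _ => α.1 i, fun _ hj => α.2 i hj⟩
  invFun f := ⟨fun i => (f i).1 0, fun i hi => (f i).2 0 hi⟩
  left_inv α := rfl
  right_inv f := by
    funext i; apply Subtype.ext; funext j
    obtain rfl : j = 0 := Subsingleton.elim _ _
    rfl

lemma splitE_up (α : Sx D) (i : Fin n) :
    splitE D (α.up i) = Function.update (splitE D α) i ((splitE D α i).up 0) := by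
  funext j
  apply Subtype.ext; funext k
  obtain rfl : k = 0 := Subsingleton.elim _ _
  by_cases hj : j = i
  · subst hj; simp [splitE, Sx.up]
  · simp [splitE, Sx.up, hj]

lemma splitE_can (α : Sx D) (i : Fin n) : (splitE D α i).can 0 ↔ α.can i := Iff.rfl

lemma splitE_down (α : Sx D) (i : Fin n) (h : α.can i) :
    splitE D (α.down i h) =
      Function.update (splitE D α) i ((splitE D α i).down 0 ((splitE_can D α i).mpr h)) := by
  funext j
  apply Subtype.ext; funext k
  obtain rfl : k = 0 := Subsingleton.elim _ _
  by_cases hj : j = i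
  · subst hj; simp [splitE, Sx.down]
  · simp [splitE, Sx.down, hj]

/-- the tensor iso -/
def phi : V (Dat.ofK D mu h) ≃ₗ[K] ⨂[K] j, (factor D mu h j).carrier :=
  (vb D mu h).equiv (Basis.piTensorProduct (fb D mu h)) (splitE D)

lemma phi_vb (α : Sx D) : phi D mu h (vb D mu h α) =
    PiTensorProduct.tprod K fun j => fb D mu h j (splitE D α j) := by
  rw [phi, Module.Basis.equiv_apply, Basis.piTensorProduct_apply]

lemma upd_fb (α : ∀ i, Sx (D1 D i)) (i : Fin n) (β : Sx (D1 D i)) :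
    (fun j => fb D mu h j (Function.update α i β j)) =
      Function.update (fun j => fb D mu h j (α j)) i (fb D mu h i β) := by
  funext j
  by_cases hj : j = i
  · subst hj; simp
  · simp [hj]

lemma phi_ext (a : In K n) (i : Fin n) (b : In K 1)
    (hab : ∀ α, phi D mu h (a • vb D mu h α) = tprodMap K n (factor D mu h) i b (phi D mu h (vb D mu h α)))
    (v) : phi D mu h (a • v) = tprodMap K n (factor D mu h) i b (phi D mu h v) := by
  have : (phi D mu h).toLinearMap ∘ₗ (Algebra.lsmul K K _ a) =
      (tprodMap K n (factor D mu h) i b) ∘ₗ (phi D mu h).toLinearMap :=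
    (vb D mu h).ext hab
  exact LinearMap.congr_fun this v

lemma realizes_tensor : RealizesTensor K n (factor D mu h) (V (Dat.ofK D mu h)) := by
  classical
  refine ⟨phi D mu h, fun i m => ⟨?_, ?_, ?_⟩⟩
  · apply phi_ext
    intro α
    rw [x_vb, map_smul, phi_vb, phi_vb, tprodMap_tprod, splitE_up, upd_fb]
    have : xEl K 1 0 • fb D mu h i (splitE D α i) = (mu i + ((α.1 i : ℤ) : K)) •
      fb D mu h i ((splitE D α i).up 0) := x_vb _ _ _ _ _
    rw [this, MultilinearMap.map_update_smul]
  · apply phi_ext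
    intro α
    rw [d_vb, phi_vb, tprodMap_tprod]
    have : dEl K 1 0 • fb D mu h i (splitE D α i) = if h' : (splitE D α i).can 0 then
      fb D mu h i ((splitE D α i).down 0 h') else 0 := d_vb _ _ _ _ _
    rw [this]
    by_cases hc : α.can i
    · rw [dif_pos hc, dif_pos ((splitE_can D α i).mpr hc), phi_vb, splitE_down, upd_fb]
    · rw [dif_neg hc, dif_neg (fun h' => hc ((splitE_can D α i).mp h')), map_zero,
        MultilinearMap.map_update_zero]
  · apply phi_ext
    intro α
    rw [i_vb, phi_vb, phi_vb, tprodMap_tprod, splitE_up, upd_fb]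
    have : intEl K 1 0 • fb D mu h i (splitE D α i) =
      fb D mu h i ((splitE D α i).up 0) := i_vb _ _ _ _ _
    rw [this]

lemma ofK_P (D : Set (Fin n)) (mu : Fin n → K) (h) (h1 : D = Set.univ) :
    Nonempty (V (Dat.ofK D mu h) ≃ₗ[In K n] P K n) := by
  subst h1
  obtain rfl : mu = 1 := funext fun i => h i trivial
  obtain ⟨f, -⟩ := P_iso (K := K) (n := n)
  exact ⟨f⟩

lemma realizesMD (lam : Fin n → K) (hl : ∀ i ∉ D, mu i = lam i) :
    RealizesMD K n lam D (V (Dat.ofK D mu h)) := by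
  refine ⟨factor D mu h, ?_, ?_, realizes_tensor D mu h⟩
  · intro i hi
    apply ofK_P
    ext j; simp [D1, hi]
  · intro i hi
    rw [← hl i hi]
    have key : ∀ (S : Set (Fin 1)) (hS : S = ∅) (m : Fin 1 → K) (h'),
      Nonempty (V (Dat.ofK S m h') ≃ₗ[In K 1] Msl K 1 (m 0)) := by
      rintro S rfl m h'
      exact Msl_iso m h'
    apply key _ _ (fun _ => mu i)
    ext j; simp [D1, hi]

end

/-! ### generalized weight -/

lemma genWS_indep (M : Type*) [AddCommGroup M] [Module K M] [Module (In K n) M]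
    [IsScalarTower K (In K n) M] : iSupIndep (fun lam => genWeightSpace K n M lam) := by
  let f : Fin n → Module.End K M := fun i => Algebra.lsmul K K M (HEl K n i)
  have hcomm : ∀ i j, Commute (f i) (f j) := by
    intro i j
    show f i * f j = f j * f i
    simp only [f, ← map_mul, hEl_comm]
  have := Module.End.independent_iInf_maxGenEigenspace_of_forall_mapsTo f (by
    intro i j φ
    exact Module.End.mapsTo_maxGenEigenspace_of_comm (hcomm j i) φ)
  refine this.mono ?_
  rintro lam m ⟨N, hN⟩
  rw [Submodule.mem_iInf]
  intro i
  rw [Module.End.mem_maxGenEigenspace]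
  refine ⟨N, ?_⟩
  have : (f i - lam i • 1) ^ N = Algebra.lsmul K K M ((HEl K n i - algebraMap K _ (lam i)) ^ N) := by
    rw [map_pow, map_sub, AlgHom.commutes, Algebra.algebraMap_eq_smul_one]
  rw [this]
  exact hN i

lemma isGenWeight_of_sup (M : Type*) [AddCommGroup M] [Module K M] [Module (In K n) M]
    [IsScalarTower K (In K n) M] (h : ⨆ lam, genWeightSpace K n M lam = ⊤) :
    IsGenWeightModule K n M := by
  unfold IsGenWeightModule
  letI := Classical.decEq (Fin n → K)
  exact (DirectSum.isInternal_submodule_iff_iSupIndep_and_iSup_eq_top _).mpr ⟨genWS_indep M, h⟩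

lemma V_genWeight (d : Dat K n) : IsGenWeightModule K n (V d) := by
  apply isGenWeight_of_sup
  rw [eq_top_iff]
  rintro v -
  induction v using V_induct with
  | h0 => exact Submodule.zero_mem _
  | hadd v w h1 h2 => exact Submodule.add_mem _ h1 h2
  | hs α r =>
    refine Submodule.mem_iSup_of_mem (fun i => d.mu i + α.1 i) ?_
    obtain ⟨s, hs⟩ := exists_eps d
    refine ⟨s, fun i => ?_⟩
    apply V_ext
    intro β
    by_cases hb : β = α
    · subst hb; rw [Hpow_sg d s hs, map_zero]
    · rw [cf_Hpow, cf_sg_ne d hb, mul_zero, map_zero]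

lemma V_supp (d : Dat K n) (lam : Fin n → K) (hl : ∀ i ∉ d.D, d.mu i = lam i)
    (hl0 : ∀ i ∈ d.D, lam i = 0) : supp K n (V d) ⊆ orbitOf K n lam := by
  intro nu hnu
  obtain ⟨v, ⟨N, hN⟩, hv⟩ := Submodule.exists_mem_ne_zero_of_ne_bot hnu
  obtain ⟨α, hα⟩ : ∃ α, cf d α v ≠ 0 := by
    by_contra hc; push Not at hc
    exact hv (V_ext _ fun α => by rw [hc, map_zero])
  intro i
  have : d.mu i + α.1 i - nu i = 0 := by
    by_contra hc
    exact hα (cf_eq_zero d (hN i) hc)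
  by_cases hi : i ∈ d.D
  · refine ⟨1 + α.1 i, ?_⟩
    rw [hl0 i hi]
    rw [d.hD1 i hi] at this
    push_cast
    linear_combination -this
  · refine ⟨α.1 i, ?_⟩
    rw [hl i hi] at this
    linear_combination -this

lemma V_InGWD (d : Dat K n) (lam : Fin n → K) (hl : ∀ i ∉ d.D, d.mu i = lam i)
    (hl0 : ∀ i ∈ d.D, lam i = 0) : InGWD K n lam d.D (V d) := by
  refine ⟨V_genWeight d, V_supp d lam hl hl0, ?_⟩
  intro p q _ hs
  obtain ⟨e⟩ := subquot p q hs
  exact (realizesMD d.D d.mu d.hD1 lam hl).congr e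

lemma InGWD.congr {lam : Fin n → K} {D : Set (Fin n)} {M N : Type*}
    [AddCommGroup M] [Module K M] [Module (In K n) M] [IsScalarTower K (In K n) M]
    [AddCommGroup N] [Module K N] [Module (In K n) N] [IsScalarTower K (In K n) N]
    (e : M ≃ₗ[In K n] N) (h1 : ⨆ lam, genWeightSpace K n M lam = ⊤)
    (h : InGWD K n lam D M) (hs : IsSimpleModule (In K n) N) : InGWD K n lam D N := by
  have hm : ∀ nu v, v ∈ genWeightSpace K n M nu → e v ∈ genWeightSpace K n N nu := by
    rintro nu v ⟨N, hN⟩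
    exact ⟨N, fun i => by rw [← map_smul, hN, map_zero]⟩
  have hm' : ∀ nu v, v ∈ genWeightSpace K n N nu → e.symm v ∈ genWeightSpace K n M nu := by
    rintro nu v ⟨N, hN⟩
    exact ⟨N, fun i => by rw [← map_smul, hN, map_zero]⟩
  refine ⟨isGenWeight_of_sup _ ?_, ?_, ?_⟩
  · rw [eq_top_iff]
    rintro v -
    have : e.symm v ∈ (⨆ nu, genWeightSpace K n N nu).comap (e.restrictScalars K).toLinearMap := by
      have h2 : ⨆ nu, genWeightSpace K n M nu ≤
        (⨆ nu, genWeightSpace K n N nu).comap (e.restrictScalars K).toLinearMap := by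
        refine iSup_le fun nu v hv => ?_
        exact Submodule.mem_iSup_of_mem nu (hm nu v hv)
      apply h2; rw [h1]; trivial
    have h3 : e (e.symm v) ∈ (⨆ nu, genWeightSpace K n N nu) := this
    simpa using h3
  · intro nu hnu
    apply h.2.1
    obtain ⟨v, hv, hv0⟩ := Submodule.exists_mem_ne_zero_of_ne_bot hnu
    intro hb
    have := hm' nu v hv
    rw [hb, Submodule.mem_bot] at this
    exact hv0 (by simpa using this)
  · intro p q hpq hsq
    have hMs : IsSimpleModule (In K n) M := IsSimpleModule.congr e
    have hq : q = ⊤ ∧ p = ⊥ := by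
      have hnt := hsq.nontrivial
      have hne := Submodule.Quotient.nontrivial_iff.mp hnt
      have hle : ¬ q ≤ p := by
        intro hle; apply hne; rw [eq_top_iff]; intro x _; exact hle x.2
      rcases eq_bot_or_eq_top q with hq | hq
      · exact absurd (hq ▸ bot_le) hle
      · rcases eq_bot_or_eq_top p with hp | hp
        · exact ⟨hq, hp⟩
        · exact absurd (hp ▸ le_top) hle
    obtain ⟨rfl, rfl⟩ := hq
    have e0 : (Submodule.comap (⊤ : Submodule (In K n) M).subtype ⊥) = ⊥ := by
      rw [eq_bot_iff]; rintro x hx; exact (Submodule.mem_bot _).mpr (Subtype.ext hx)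
    have e1 : (Submodule.comap (⊤ : Submodule (In K n) N).subtype ⊥) = ⊥ := by
      rw [eq_bot_iff]; rintro x hx; exact (Submodule.mem_bot _).mpr (Subtype.ext hx)
    have eM := (Submodule.quotEquivOfEqBot _ e0).trans Submodule.topEquiv
    have eN := (Submodule.quotEquivOfEqBot _ e1).trans Submodule.topEquiv
    have := h.2.2 ⊥ ⊤ bot_le (IsSimpleModule.congr eM)
    exact this.congr (eM.trans (e.trans eN.symm))

lemma P_InGWD (lam : Fin n → K) (hl0 : ∀ i, lam i = 0) : InGWD K n lam Set.univ (P K n) := by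
  obtain ⟨f, -⟩ := P_iso (K := K) (n := n)
  have hV := V_InGWD (Dat.ofK (K := K) (n := n) Set.univ 1 (fun _ _ => rfl)) lam
    (fun i hi => absurd trivial hi) (fun i _ => hl0 i)
  refine InGWD.congr f ?_ hV inferInstance
  have h1 := V_genWeight (Dat.ofK (K := K) (n := n) Set.univ 1 (fun _ _ => rfl))
  unfold IsGenWeightModule at h1
  letI := Classical.decEq (Fin n → K)
  exact h1.submodule_iSup_eq_top

lemma indec_of_simple (M : Type*) [AddCommGroup M] [Module K M] [Module (In K n) M]
    [IsScalarTower K (In K n) M] [IsSimpleModule (In K n) M] : IsIndecomposableMod K n M := by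
  refine ⟨IsSimpleModule.nontrivial (In K n) M, fun p q h => ?_⟩
  rcases eq_bot_or_eq_top p with hp | hp
  · exact Or.inl hp
  · right
    subst hp
    simpa using h.disjoint

end PartD

noncomputable section PartE

variable {K : Type u} [Field K] [CharZero K] {n : ℕ}

variable (K n) in
/-- the projector -/
def eP : In K n := ((List.finRange n).map fun i => 1 - intEl K n i * dEl K n i).prod

/-- origin -/
def o0 : Sx (Set.univ : Set (Fin n)) := ⟨0, fun _ _ => le_rfl⟩

lemma list_fix {M : Type*} [AddCommGroup M] [Module (In K n) M] (v : M)
    (h : ∀ i, dEl K n i • v = 0) (L : List (Fin n)) :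
    (L.map fun i => 1 - intEl K n i * dEl K n i).prod • v = v := by
  induction L with
  | nil => simp
  | cons i L ih => 
    rw [List.map_cons, List.prod_cons, mul_smul, ih, sub_smul, one_smul, mul_smul, h, smul_zero,
      sub_zero]

lemma one_sub_pb (i : Fin n) (α) (hi : α.1 i ≠ 0) :
    (1 - intEl K n i * dEl K n i) • pb K n α = 0 := by
  have hc : α.can i := fun _ => lt_of_le_of_ne (α.2 i trivial) hi.symm
  rw [sub_smul, one_smul, mul_smul, d_vb, dif_pos hc, i_vb, α.up_down, sub_self]

lemma one_sub_pb0 (i : Fin n) (α) (hi : α.1 i = 0) :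
    (1 - intEl K n i * dEl K n i) • pb K n α = pb K n α := by
  have hc : ¬ α.can i := fun h => by have := h trivial; omega
  rw [sub_smul, one_smul, mul_smul, d_vb, dif_neg hc, smul_zero, sub_zero]

lemma list_kill (L : List (Fin n)) (α) (i) (hi : i ∈ L) (h : α.1 i ≠ 0) :
    (L.map fun i => 1 - intEl K n i * dEl K n i).prod • pb K n α = 0 := by
  have key : ∀ L : List (Fin n), (L.map fun i => 1 - intEl K n i * dEl K n i).prod • pb K n α = 0 ∨
      (L.map fun i => 1 - intEl K n i * dEl K n i).prod • pb K n α = pb K n α := by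
    intro L
    induction L with
    | nil => simp
    | cons j L ih =>
      rw [List.map_cons, List.prod_cons, mul_smul]
      rcases ih with ih | ih
      · left; rw [ih, smul_zero]
      · rw [ih]
        by_cases hj : α.1 j = 0
        · right; exact one_sub_pb0 j α hj
        · left; exact one_sub_pb j α hj
  induction L with
  | nil => simp at hi
  | cons j L ih =>
    rw [List.map_cons, List.prod_cons, mul_smul]
    rcases List.mem_cons.mp hi with rfl | hi
    · rcases key L with h1 | h1
      · rw [h1, smul_zero]
      · rw [h1]; exact one_sub_pb i α h
    · rw [ih hi, smul_zero]

lemma eP_pb_ne (α) (h : α ≠ o0) : eP K n • pb K n α = 0 := by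
  obtain ⟨i, hi⟩ : ∃ i, α.1 i ≠ 0 := by
    by_contra hc; push Not at hc
    exact h (Subtype.ext (funext hc))
  exact list_kill _ α i (List.mem_finRange i) hi

lemma eP_pb : eP K n • pb K n o0 = pb K n o0 := by
  apply list_fix
  intro i
  rw [d_vb, dif_neg]
  intro h
  have := h trivial
  simp [o0] at this

lemma exists_psi : ∃ ψ : VP K n →ₗ[In K n] In K n, ψ (pb K n o0) = eP K n := by
  classical
  have hex : ∀ α, ∃ a : In K n, a • pb K n o0 = pb K n α := by
    intro α
    have h1 : Submodule.span (In K n) {pb K n o0} = ⊤ := by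
      rcases eq_bot_or_eq_top (Submodule.span (In K n) {pb K n o0}) with h | h
      · rw [Submodule.span_singleton_eq_bot] at h
        exact absurd h ((pb K n).ne_zero _)
      · exact h
    exact Submodule.mem_span_singleton.mp (h1 ▸ trivial)
  choose a ha using hex
  let g : Sx (Set.univ : Set (Fin n)) → In K n := fun α => a α * eP K n
  have g0 : ∀ α, g α • pb K n o0 = pb K n α := fun α => by
    simp only [g]; rw [mul_smul, eP_pb, ha]
  have g1 : ∀ α β, β ≠ o0 → g α • pb K n β = 0 := fun α β hb => by
    simp only [g]; rw [mul_smul, eP_pb_ne β hb, smul_zero]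
  obtain ⟨ψ, hψ⟩ := exists_lin (K := K) (n := n) Set.univ 1 (fun _ _ => rfl) g (by
    intro i α
    apply in_ext_pb
    intro β
    rw [smul_eq_mul, mul_smul, smul_assoc]
    by_cases hb : β = o0
    · subst hb; rw [g0, g0, x_vb]
    · rw [g1 _ _ hb, g1 _ _ hb, smul_zero, smul_zero]) (by
    intro i α
    apply in_ext_pb
    intro β
    rw [smul_eq_mul, mul_smul]
    by_cases hb : β = o0
    · subst hb; rw [g0, d_vb]
      split_ifs
      · rw [g0]
      · rw [zero_smul]
    · rw [g1 _ _ hb, smul_zero]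
      split_ifs
      · rw [g1 _ _ hb]
      · rw [zero_smul]) (by
    intro i α
    apply in_ext_pb
    intro β
    rw [smul_eq_mul, mul_smul]
    by_cases hb : β = o0
    · subst hb; rw [g0, g0, i_vb]
    · rw [g1 _ _ hb, g1 _ _ hb, smul_zero])
  refine ⟨ψ, ?_⟩
  rw [hψ]
  apply in_ext_pb
  intro β
  by_cases hb : β = o0
  · subst hb; rw [g0, eP_pb]
  · rw [g1 _ _ hb, eP_pb_ne _ hb]

lemma realizes_vac {lam : Fin n → K} {M : Type*}
    [AddCommGroup M] [Module K M] [Module (In K n) M] [IsScalarTower K (In K n) M]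
    (h : RealizesMD K n lam Set.univ M) : ∃ v : M, v ≠ 0 ∧ eP K n • v = v := by
  obtain ⟨Mi, h1, -, φ, hφ⟩ := h
  have e : ∀ i, (Mi i).carrier ≃ₗ[In K 1] P K 1 := fun i => (h1 i trivial).some
  let u : ∀ i, (Mi i).carrier := fun i => (e i).symm 1
  refine ⟨φ.symm (PiTensorProduct.tprod K u), ?_, ?_⟩
  · intro h0
    have h2 : PiTensorProduct.tprod K u = 0 := by
      have := congrArg φ h0
      simpa using this
    let L : (⨂[K] j, (Mi j).carrier) →ₗ[K] K := PiTensorProduct.lift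
      ((MultilinearMap.mkPiAlgebra K (Fin n) K).compLinearMap
        (fun i => (MvPolynomial.lcoeff K (0 : Fin 1 →₀ ℕ)).comp ((e i).restrictScalars K).toLinearMap))
    have h3 : L (PiTensorProduct.tprod K u) = 1 := by
      simp [L, u]
    rw [h2, map_zero] at h3
    exact zero_ne_one h3
  · apply list_fix
    intro i
    apply φ.injective
    rw [(hφ i _).2.1, LinearEquiv.apply_symm_apply, tprodMap_tprod, map_zero]
    have : dEl K 1 0 • u i = 0 := by
      simp only [u]
      rw [← map_smul, dEl_smul, MvPolynomial.pderiv_one, map_zero]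
    rw [this, MultilinearMap.map_update_zero]

lemma unique_P {lam : Fin n → K} (M : Type*)
    [AddCommGroup M] [Module K M] [Module (In K n) M] [IsScalarTower K (In K n) M]
    (h : InGWD K n lam Set.univ M) (hM : IsIndecomposableMod K n M) :
    Nonempty (M ≃ₗ[In K n] P K n) := by
  obtain ⟨ψ, hψ⟩ := exists_psi (K := K) (n := n)
  let f : M → (VP K n →ₗ[In K n] M) := fun v => (LinearMap.toSpanSingleton (In K n) M v).comp ψ
  have hf : ∀ v, f v (pb K n o0) = eP K n • v := fun v => by
    simp only [f, LinearMap.comp_apply, hψ, LinearMap.toSpanSingleton_apply]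
  have htop : ⨆ v, LinearMap.range (f v) = ⊤ := by
    by_contra hne
    obtain ⟨x, hx⟩ : ∃ x, x ∉ ⨆ v, LinearMap.range (f v) := by
      by_contra hc; push Not at hc
      exact hne (eq_top_iff.mpr fun x _ => hc x)
    let Q := Submodule.span (In K n) {x}
    have hxQ : x ∈ Q := Submodule.mem_span_singleton_self x
    have : Module.Finite (In K n) Q := Module.Finite.span_singleton (In K n) x
    have hne' : Submodule.comap Q.subtype (⨆ v, LinearMap.range (f v)) ≠ ⊤ := by
      intro ht
      have : (⟨x, hxQ⟩ : Q) ∈ Submodule.comap Q.subtype (⨆ v, LinearMap.range (f v)) := by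
        rw [ht]; trivial
      exact hx this
    obtain ⟨p', hp', hle⟩ := (eq_top_or_exists_le_coatom _).resolve_left hne'
    have hs : IsSimpleModule (In K n) (Q ⧸ p') := isSimpleModule_iff_isCoatom.mpr hp'
    have hcm : Submodule.comap Q.subtype (Submodule.map Q.subtype p') = p' :=
      Submodule.comap_map_eq_of_injective Q.injective_subtype p'
    have hr := h.2.2 (Submodule.map Q.subtype p') Q (Submodule.map_subtype_le Q p')
    have hs2 : IsSimpleModule (In K n) (Q ⧸ Submodule.comap Q.subtype (Submodule.map Q.subtype p')) := by
      rw [hcm]; exact hs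
    obtain ⟨v, hv, hev⟩ := realizes_vac (hr hs2)
    obtain ⟨y, rfl⟩ := Submodule.Quotient.mk_surjective _ v
    apply hv
    rw [← hev, ← Submodule.Quotient.mk_smul, Submodule.Quotient.mk_eq_zero]
    apply hle.trans hcm.ge
    show eP K n • (y : M) ∈ ⨆ v, LinearMap.range (f v)
    exact Submodule.mem_iSup_of_mem y.1 ⟨_, hf _⟩
  have hss : IsSemisimpleModule (In K n) M :=
    isSemisimpleModule_of_isSemisimpleModule_submodule' (fun v => IsSemisimpleModule.range (f v)) htop
  have := hM.1
  obtain ⟨v, hv⟩ : ∃ v, f v ≠ 0 := by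
    by_contra hc; push Not at hc
    have : (⊤ : Submodule (In K n) M) = ⊥ := by
      rw [← htop, eq_bot_iff]
      refine iSup_le fun v => ?_
      rw [hc v, LinearMap.range_zero]
    exact top_ne_bot this
  obtain ⟨q, hq⟩ := exists_isCompl (LinearMap.range (f v))
  have hrt : LinearMap.range (f v) = ⊤ := by
    rcases hM.2 _ _ hq with h1 | h1
    · exact absurd (LinearMap.range_eq_bot.mp h1) hv
    · subst h1; simpa using hq.codisjoint
  obtain ⟨g, -⟩ := P_iso (K := K) (n := n)
  exact ⟨(LinearEquiv.ofBijective (f v) ⟨LinearMap.injective_of_ne_zero hv,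
    LinearMap.range_eq_top.mp hrt⟩).symm.trans g⟩

end PartE

noncomputable section PartF

open Polynomial in
lemma exists_ring (K : Type u) [Field K] (s : ℕ) : ∃ (R : Type u) (_ : CommRing R) (_ : Algebra K R)
    (eps : R), eps ^ (s + 1) = 0 ∧ eps ^ s ≠ 0 ∧ (∀ r, eps * r = 0 → ∃ c : K, r = c • eps ^ s) ∧
      Algebra.adjoin K {eps} = ⊤ := by
  refine ⟨K[X] ⧸ Ideal.span {(X : K[X]) ^ (s + 1)}, inferInstance, inferInstance,
    Ideal.Quotient.mk _ X, ?_, ?_, ?_, ?_⟩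
  · rw [← map_pow, Ideal.Quotient.eq_zero_iff_mem]
    exact Ideal.mem_span_singleton_self _
  · rw [← map_pow, Ne, Ideal.Quotient.eq_zero_iff_mem, Ideal.mem_span_singleton,
      pow_dvd_pow_iff X_ne_zero not_isUnit_X]
    omega
  · intro r hr
    obtain ⟨p, rfl⟩ := Ideal.Quotient.mk_surjective r
    rw [← map_mul, Ideal.Quotient.eq_zero_iff_mem, Ideal.mem_span_singleton, pow_succ',
      mul_dvd_mul_iff_left X_ne_zero] at hr
    obtain ⟨q, rfl⟩ := hr
    refine ⟨q.coeff 0, ?_⟩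
    rw [← map_pow, ← Ideal.Quotient.mkₐ_eq_mk K, ← map_smul, Ideal.Quotient.mkₐ_eq_mk,
      Ideal.Quotient.eq, Ideal.mem_span_singleton]
    have : (X : K[X]) ^ s * q - q.coeff 0 • X ^ s = X ^ s * (q - C (q.coeff 0)) := by
      rw [smul_eq_C_mul]; ring
    rw [this, pow_succ]
    apply mul_dvd_mul_left
    rw [X_dvd_iff]; simp
  · rw [eq_top_iff]
    rintro r -
    obtain ⟨p, rfl⟩ := Ideal.Quotient.mk_surjective r
    have : Ideal.Quotient.mk (Ideal.span {(X : K[X]) ^ (s + 1)}) p =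
      aeval (Ideal.Quotient.mk (Ideal.span {(X : K[X]) ^ (s + 1)}) X) p := by
      rw [← Ideal.Quotient.mkₐ_eq_mk K, aeval_algHom_apply, aeval_X_left_apply]
    rw [this]
    exact Polynomial.aeval_mem_adjoin_singleton K _

variable {K : Type u} [Field K] [CharZero K] {n : ℕ}

lemma exists_dat (s : ℕ) (D : Set (Fin n)) (j : Fin n) (hj : j ∉ D) (mu : Fin n → K)
    (h : ∀ i ∈ D, mu i = 1) : ∃ d : Dat K n, d.D = D ∧ d.mu = mu ∧ d.eps ^ (s + 1) = 0 ∧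
      d.eps ^ s ≠ 0 ∧ (∀ r, d.eps * r = 0 → ∃ c : K, r = c • d.eps ^ s) ∧ d.k j = 1 := by
  classical
  obtain ⟨R, i1, i2, eps, h1, h2, h3, h4⟩ := exists_ring K s
  refine ⟨@Dat.mk K _ _ n R i1 i2 D mu eps (Pi.single j 1) h ?_ ⟨_, h1⟩ ?_, rfl, rfl, h1, h2, h3, by simp⟩
  · intro i hi
    have : i ≠ j := by rintro rfl; exact hj hi
    simp [this]
  · rw [eq_top_iff, ← h4]
    apply Algebra.adjoin_le
    intro x hx
    rw [Set.mem_singleton_iff.mp hx]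
    set A := Algebra.adjoin K (Set.range fun i => algebraMap K R (mu i) +
      (Pi.single j 1 : Fin n → K) i • eps)
    have hh : algebraMap K R (mu j) + (Pi.single j 1 : Fin n → K) j • eps ∈ A :=
      Algebra.subset_adjoin ⟨j, rfl⟩
    have := A.sub_mem hh (A.algebraMap_mem (mu j))
    simpa using this

lemma socle (d : Dat K n) (s : ℕ)
    (h3 : ∀ r, d.eps * r = 0 → ∃ c : K, r = c • d.eps ^ s) (W : Submodule (In K n) (V d))
    (hW : W ≠ ⊥) : sg d (org d) (d.eps ^ s) ∈ W := by
  classical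
  obtain ⟨w, hw, hw0⟩ := W.ne_bot_iff.mp hW
  obtain ⟨α, hα⟩ : ∃ α, cf d α w ≠ 0 := by
    by_contra hc; push Not at hc
    exact hw0 (V_ext _ fun α => by rw [hc, map_zero])
  have hm := cf_mem W hw α (org d)
  have hex : ∃ N, d.eps ^ N * cf d α w = 0 := by
    obtain ⟨t, ht⟩ := exists_eps d
    exact ⟨t, by rw [ht, zero_mul]⟩
  have h1 := Nat.find_spec hex
  obtain ⟨N, hN⟩ : ∃ N, Nat.find hex = N + 1 := by
    apply Nat.exists_eq_succ_of_ne_zero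
    intro h0
    rw [h0, pow_zero, one_mul] at h1
    exact hα h1
  have h2 : ¬ _ := Nat.find_min hex (m := N) (by omega)
  rw [hN, pow_succ', mul_assoc] at h1
  obtain ⟨c, hc⟩ := h3 _ h1
  have hc0 : c ≠ 0 := by
    rintro rfl
    rw [zero_smul] at hc; exact h2 hc
  have hm2 := R_mem W hm (d.eps ^ N)
  rw [hc] at hm2
  have := K_smul_mem W c⁻¹ hm2
  rwa [← map_smul, smul_smul, inv_mul_cancel₀ hc0, one_smul] at this

lemma V_indec (d : Dat K n) (s : ℕ) (h2 : d.eps ^ s ≠ 0)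
    (h3 : ∀ r, d.eps * r = 0 → ∃ c : K, r = c • d.eps ^ s) : IsIndecomposableMod K n (V d) := by
  have hne : sg d (org d) (d.eps ^ s) ≠ 0 := by
    intro h
    have := cf_sg_self d (org d) (d.eps ^ s)
    rw [h, map_zero] at this
    exact h2 this.symm
  refine ⟨⟨_, 0, hne⟩, ?_⟩
  intro p q hpq
  by_contra hcon
  push Not at hcon
  have := (Submodule.disjoint_def.mp hpq.disjoint) _ (socle d s h3 p hcon.1) (socle d s h3 q hcon.2)
  exact hne this

lemma not_iso (d d' : Dat K n) (s t : ℕ) (hst : s < t) (j : Fin n) (hm : d.mu j = d'.mu j)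
    (h1 : d.eps ^ (s + 1) = 0) (ht1 : d'.eps ^ (t + 1) = 0) (ht2 : d'.eps ^ t ≠ 0)
    (hk' : d'.k j = 1) : ¬ Nonempty (V d ≃ₗ[In K n] V d') := by
  rintro ⟨e⟩
  have hb : ∀ N, cf d' (org d') ((HEl K n j - algebraMap K _ (d'.mu j)) ^ N • sg d' (org d') 1) =
      d'.eps ^ N := by
    intro N
    rw [cf_Hpow, tau_sub, cf_sg_self, mul_one, hk']
    simp [org]
  have ha : (HEl K n j - algebraMap K _ (d'.mu j)) ^ (t + 1) • sg d' (org d') 1 = 0 := by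
    apply V_ext
    intro α
    rw [map_zero]
    by_cases hα : α = org d'
    · subst hα; rw [hb, ht1]
    · rw [cf_Hpow, cf_sg_ne d' hα, mul_zero]
  let v := e.symm (sg d' (org d') 1)
  have hv : (HEl K n j - algebraMap K _ (d.mu j)) ^ (t + 1) • v = 0 := by
    simp only [v]
    rw [← map_smul, hm, ha, map_zero]
  have hv2 : (HEl K n j - algebraMap K _ (d.mu j)) ^ (s + 1) • v = 0 := by
    apply V_ext
    intro α
    rw [map_zero]
    by_cases hα : α.1 j = 0
    · rw [cf_Hpow, tau_sub, hα]
      simp [smul_pow, h1]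
    · have : cf d α v = 0 := by
        apply cf_eq_zero d hv
        simpa using hα
      rw [cf_Hpow, this, mul_zero]
  have hv3 : (HEl K n j - algebraMap K _ (d.mu j)) ^ (s + 1) • sg d' (org d') 1 = 0 := by
    have := congrArg e hv2
    simpa [v] using this
  have := hb (s + 1)
  rw [← hm, hv3, map_zero] at this
  apply ht2
  rw [show t = (s + 1) + (t - (s + 1)) by omega, pow_add, ← this, zero_mul]

lemma forward (lam : Fin n → K) (hnorm : IsNormalized K n lam)
    (D : Set (Fin n)) (hD : D ⊆ DD K n lam) (j : Fin n) (hj : j ∉ D)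
    (k : ℕ) (Ms : Fin k → ModN K n)
    (H : ∀ (M : Type u) [AddCommGroup M] [Module K M] [Module (In K n) M] [IsScalarTower K (In K n) M],
          InGWD K n lam D M → IsIndecomposableMod K n M →
          ∃ j, Nonempty (M ≃ₗ[In K n] (Ms j).carrier)) : False := by
  classical
  let mu : Fin n → K := fun i => if i ∈ D then 1 else lam i
  have hmu : ∀ i ∈ D, mu i = 1 := fun i hi => if_pos hi
  choose d hd1 hd2 hd3 hd4 hd5 hd6 using fun s => exists_dat s D j hj mu hmu
  have hex : ∀ s, ∃ i, Nonempty (V (d s) ≃ₗ[In K n] (Ms i).carrier) := by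
    intro s
    apply H
    · have := V_InGWD (d s) lam (by
        intro i hi; rw [hd1] at hi; rw [hd2]; exact if_neg hi) (by
        intro i hi; rw [hd1] at hi; exact hnorm i (hD hi))
      rwa [hd1] at this
    · exact V_indec (d s) s (hd4 s) (hd5 s)
  choose c hc using hex
  obtain ⟨s, t, hne, hst⟩ := Finite.exists_ne_map_eq_of_infinite c
  have key : ∀ s t, s < t → c s = c t → False := by
    intro s t hlt hst
    obtain ⟨e1⟩ := hc s
    obtain ⟨e2⟩ := hc t
    rw [← hst] at e2
    exact not_iso (d s) (d t) s t hlt j (by rw [hd2, hd2]) (hd3 s) (hd3 t) (hd4 t) (hd6 t)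
      ⟨e1.trans e2.symm⟩
  rcases lt_or_gt_of_ne hne with h | h
  · exact key s t h hst
  · exact key t s h hst.symm

end PartF

/-- `GW(𝕀_n, 𝒟_Ω)` is of finite representation type iff `Ω = ℤ^n` and
`𝒟_Ω = {1,…,n}`, in which case `P_n` is the unique indecomposable module in it. -/
theorem statement14 (K : Type u) [Field K] [CharZero K] (n : ℕ)
    (lam : Fin n → K) (hnorm : IsNormalized K n lam)
    (D : Set (Fin n)) (hD : D ⊆ DD K n lam) :
    ((∃ (k : ℕ) (Ms : Fin k → ModN K n),
        ∀ (M : Type u) [AddCommGroup M] [Module K M] [Module (In K n) M] [IsScalarTower K (In K n) M],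
          InGWD K n lam D M → IsIndecomposableMod K n M →
          ∃ j, Nonempty (M ≃ₗ[In K n] (Ms j).carrier)) ↔
      (DD K n lam = Set.univ ∧ D = Set.univ)) ∧
    ((DD K n lam = Set.univ ∧ D = Set.univ) →
      InGWD K n lam D (P K n) ∧ IsIndecomposableMod K n (P K n) ∧
      ∀ (M : Type*) [AddCommGroup M] [Module K M] [Module (In K n) M] [IsScalarTower K (In K n) M],
        InGWD K n lam D M → IsIndecomposableMod K n M →
        Nonempty (M ≃ₗ[In K n] P K n)) := by
  constructor
  · constructor
    · rintro ⟨k, Ms, H⟩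
      have hDu : D = Set.univ := by
        by_contra hne
        obtain ⟨j, hj⟩ := (Set.ne_univ_iff_exists_notMem D).mp hne
        exact forward lam hnorm D hD j hj k Ms H
      exact ⟨Set.univ_subset_iff.mp (hDu ▸ hD), hDu⟩
    · rintro ⟨-, rfl⟩
      refine ⟨1, fun _ => { carrier := P K n }, ?_⟩
      intro M _ _ _ _ h1 h2
      exact ⟨0, unique_P M h1 h2⟩
  · rintro ⟨h1, rfl⟩
    refine ⟨P_InGWD lam (fun i => hnorm i (hD trivial)), indec_of_simple _, ?_⟩
    intro M _ _ _ _ h1 h2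
    exact unique_P M h1 h2

end IDO
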